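/- arXiv:1710.06680 — 11 statements merged into one kernel-verified Lean document; each statement's English description precedes it below -/
import Mathlib

section
/- For every integer t ≥ 0 and every t-dominating graph G, there is a 0-dominating graph H on the same vertex set as G such that the local difference between G and H is at most 646·t⁴. -/
/-- `u` `t`-dominates `v` in `G`: there are at most `t` vertices different from `u, v`
that are adjacent to `v` and not to `u`. -/
def Dominates {V : Type*} (G : SimpleGraph V) (t : ℕ) (u v : V) : Prop :=
  {w : V | w ≠ u ∧ w ≠ v ∧ G.Adj w v ∧ ¬ G.Adj w u}.ncard ≤ t

/-- `G` is `t`-dominating: for every pair of distinct vertices, one `t`-dominates the other. -/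
def IsTDominating {V : Type*} (G : SimpleGraph V) (t : ℕ) : Prop :=
  ∀ u v : V, u ≠ v → Dominates G t u v ∨ Dominates G t v u

/-- The local difference between `G` and `H` is at most `d`. -/
def LocalDiffLE {V : Type*} (G H : SimpleGraph V) (d : ℕ) : Prop :=
  ∀ v : V, (G.neighborSet v \ H.neighborSet v).ncard
      + (H.neighborSet v \ G.neighborSet v).ncard ≤ d

namespace ThresholdApprox

open Finset
open scoped Classical

variable {V : Type*}

/-- The neighbours of `v` inside `X`. -/
noncomputable def nbr (G : SimpleGraph V) (X : Finset V) (v : V) : Finset V :=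
  {n ∈ X | G.Adj v n}

/-- The vertices of `X`, other than `y`, that are adjacent to `x` and not to `y`. -/
noncomputable def excess (G : SimpleGraph V) (X : Finset V) (x y : V) : Finset V :=
  {n ∈ X | G.Adj x n ∧ ¬ G.Adj y n ∧ n ≠ y}

/-- The vertices of `X` at which `G` and `H` disagree about adjacency to `x`. -/
noncomputable def diff (G H : SimpleGraph V) (X : Finset V) (x : V) : Finset V :=
  {n ∈ X | ¬ (G.Adj x n ↔ H.Adj x n)}

theorem diff_subset (G H : SimpleGraph V) (X : Finset V) (x : V) : diff G H X x ⊆ X :=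
  filter_subset _ _

/-- A vertex of larger rank `t`-dominates every vertex of smaller rank. -/
def IsRank (G : SimpleGraph V) (r : V → ℤ) (t : ℕ) : Prop :=
  ∀ (X : Finset V) (x y : V), r x ≤ r y → #(excess G X x y) ≤ t

/-- `H` induces a `0`-dominating graph on `X`. -/
def Nested (H : SimpleGraph V) (X : Finset V) : Prop :=
  ∀ u ∈ X, ∀ v ∈ X, (∀ w ∈ X, w ≠ u → w ≠ v → H.Adj w v → H.Adj w u) ∨
    (∀ w ∈ X, w ≠ u → w ≠ v → H.Adj w u → H.Adj w v)

/-- Some graph that is nested on `X` differs from `G` inside `X` by at most `d - b x` at each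
vertex `x`. -/
def Approximable (G : SimpleGraph V) (X : Finset V) (b : V → ℕ) (d : ℕ) : Prop :=
  ∃ H : SimpleGraph V, Nested H X ∧ ∀ x ∈ X, #(diff G H X x) + b x ≤ d

/-- The degree bound `D` below which an extreme vertex may be removed. -/
def lowDegree (t : ℕ) : ℕ := 10 * t ^ 2 + 14 * t + 2

/-- The invariant satisfied by the vertices removed as isolated ones: `X` is the set of remaining
vertices, `I` consists of the vertices removed while avoiding saturated vertices, `S` of vertices of
least rank removed regardless of saturation, and `B` of those removed together with a vertex of
greatest rank. -/
structure Removed (G : SimpleGraph V) (r : V → ℤ) (t : ℕ) (X I S B : Finset V) : Prop where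
  disjI : Disjoint X I
  disjS : Disjoint X S
  disjB : Disjoint X B
  nearMin : ∀ v ∈ I ∪ S, ∀ x ∈ X, #(excess G X v x) ≤ 5 * t + 3
  rankS : ∀ u ∈ S, ∀ x ∈ X, r u ≤ r x
  cardI : ∀ x ∈ X, #(nbr G I x) ≤ 4 * t
  cardS : ∀ x ∈ X, #(nbr G S x) ≤ 4 * t
  degB : ∀ b ∈ B, #(nbr G X b) ≤ lowDegree t
  cardB : ∀ x ∈ X, #(nbr G B x) ≤ 2 * t ∨
    #(nbr G B x) + #{y ∈ X | r x ≤ r y} ≤ 2 * t + 2 * lowDegree t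

/-- The number of errors at `x` caused by the removed vertices. -/
noncomputable def errors (G : SimpleGraph V) (I S B : Finset V) (x : V) : ℕ :=
  #(nbr G I x) + #(nbr G S x) + #(nbr G B x)

theorem mem_nbr {G : SimpleGraph V} {X : Finset V} {v n : V} :
    n ∈ nbr G X v ↔ n ∈ X ∧ G.Adj v n := by
  simp [nbr]

theorem nbr_mono (G : SimpleGraph V) {X Y : Finset V} (h : X ⊆ Y) (v : V) :
    #(nbr G X v) ≤ #(nbr G Y v) :=
  card_le_card (filter_subset_filter _ h)

theorem excess_mono (G : SimpleGraph V) {X Y : Finset V} (h : X ⊆ Y) (x y : V) :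
    #(excess G X x y) ≤ #(excess G Y x y) :=
  card_le_card (filter_subset_filter _ h)

theorem IsRank.compl {G : SimpleGraph V} {r : V → ℤ} {t : ℕ} (h : IsRank G r t) :
    IsRank Gᶜ (fun v => - r v) t := by
  intro X x y hxy
  refine le_trans (card_le_card ?_) (h X y x (by simpa using hxy))
  intro n
  simp only [excess, mem_filter, SimpleGraph.compl_adj]
  grind

theorem Nested.compl {H : SimpleGraph V} {X : Finset V} (h : Nested H X) : Nested Hᶜ X := by
  intro u hu v hv
  simp only [SimpleGraph.compl_adj]
  have := h u hu v hv
  grind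

theorem Approximable.of_compl {G : SimpleGraph V} {X : Finset V} {b : V → ℕ} {d : ℕ}
    (h : Approximable Gᶜ X b d) : Approximable G X b d := by
  obtain ⟨H, hN, hH⟩ := h
  refine ⟨Hᶜ, hN.compl, fun x hx => le_trans ?_ (hH x hx)⟩
  gcongr
  intro n
  simp only [diff, mem_filter, SimpleGraph.compl_adj]
  rintro ⟨hn, hne⟩
  refine ⟨hn, ?_⟩
  by_cases hxn : x = n
  · subst hxn; simp at hne
  · tauto

theorem Approximable.compl {G : SimpleGraph V} {X : Finset V} {b : V → ℕ} {d : ℕ}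
    (h : Approximable G X b d) : Approximable Gᶜ X b d :=
  Approximable.of_compl (by rwa [compl_compl])

/-- Adding back an isolated vertex. -/
theorem Approximable.of_erase {G : SimpleGraph V} {X : Finset V} {b b' : V → ℕ} {d : ℕ} {v : V}
    (h : Approximable G (X.erase v) b' d)
    (hb : ∀ x ∈ X.erase v, b x + (if G.Adj x v then 1 else 0) ≤ b' x)
    (hv : #(nbr G X v) + b v ≤ d) : Approximable G X b d := by
  obtain ⟨H, hN, hH⟩ := h
  let K : SimpleGraph V :=
    { Adj := fun x y => H.Adj x y ∧ x ≠ v ∧ y ≠ v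
      symm := ⟨fun x y h => ⟨h.1.symm, h.2.2, h.2.1⟩⟩
      loopless := ⟨fun x h => H.loopless.irrefl x h.1⟩ }
  have hK : ∀ x y, K.Adj x y ↔ H.Adj x y ∧ x ≠ v ∧ y ≠ v := fun x y => Iff.rfl
  refine ⟨K, ?_, ?_⟩
  · intro x hx y hy
    simp only [hK]
    by_cases hxv : x = v
    · right; intros; grind
    by_cases hyv : y = v
    · left; intros; grind
    have := hN x (mem_erase.2 ⟨hxv, hx⟩) y (mem_erase.2 ⟨hyv, hy⟩)
    simp only [mem_erase] at this
    grind
  · intro x hx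
    by_cases hxv : x = v
    · subst hxv
      refine le_trans ?_ hv
      gcongr
      intro n
      simp only [diff, nbr, mem_filter, hK]
      tauto
    · have hx' : x ∈ X.erase v := mem_erase.2 ⟨hxv, hx⟩
      have h1 := hH x hx'
      have h2 := hb x hx'
      have h3 : #(diff G K X x) ≤ #(diff G H (X.erase v) x) + (if G.Adj x v then 1 else 0) := by
        split_ifs with hadj
        · refine le_trans (card_le_card ?_) (card_insert_le v _)
          intro n
          simp only [diff, mem_filter, hK, mem_insert, mem_erase]
          tauto
        · refine card_le_card ?_
          intro n
          simp only [diff, mem_filter, hK, mem_erase]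
          by_cases hn : n = v
          · subst hn; tauto
          · tauto
      omega

theorem Removed.mono {G : SimpleGraph V} {r : V → ℤ} {t : ℕ} {X Y I S B : Finset V}
    (h : Removed G r t X I S B) (hY : Y ⊆ X) : Removed G r t Y I S B where
  disjI := h.disjI.mono_left hY
  disjS := h.disjS.mono_left hY
  disjB := h.disjB.mono_left hY
  nearMin v hv x hx := (excess_mono G hY v x).trans (h.nearMin v hv x (hY hx))
  rankS u hu x hx := h.rankS u hu x (hY hx)
  cardI x hx := h.cardI x (hY hx)
  cardS x hx := h.cardS x (hY hx)
  degB b hb := (nbr_mono G hY b).trans (h.degB b hb)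
  cardB x hx := by
    have h1 : #{y ∈ Y | r x ≤ r y} ≤ #{y ∈ X | r x ≤ r y} :=
      card_le_card (filter_subset_filter _ hY)
    rcases h.cardB x (hY hx) with h2 | h2
    · exact Or.inl h2
    · right; omega

theorem Removed.errors_le {G : SimpleGraph V} {r : V → ℤ} {t : ℕ} {X I S B : Finset V}
    (h : Removed G r t X I S B) {x : V} (hx : x ∈ X) :
    errors G I S B x ≤ 10 * t + 2 * lowDegree t := by
  have h1 := h.cardI x hx
  have h2 := h.cardS x hx
  have h3 := h.cardB x hx
  unfold errors
  omega

theorem card_nbr_insert {G : SimpleGraph V} {I : Finset V} {v : V} (hv : v ∉ I) (x : V) :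
    #(nbr G (insert v I) x) = #(nbr G I x) + (if G.Adj x v then 1 else 0) := by
  unfold nbr
  rw [filter_insert]
  split_ifs with h
  · rw [card_insert_of_notMem (by simp [hv])]
  · rfl

/-- The two extreme vertices of `X` cannot both be far from being isolated and dominating. -/
theorem low_or_low {G : SimpleGraph V} {r : V → ℤ} {t : ℕ} (hr : IsRank G r t) {X : Finset V}
    {u w : V} (hu : ∀ x ∈ X, r u ≤ r x) (hw : ∀ x ∈ X, r x ≤ r w) :
    #(nbr G X u) ≤ lowDegree t ∨ #(nbr Gᶜ X w) ≤ lowDegree t := by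
  by_contra! hcon
  obtain ⟨hA, hB⟩ := hcon
  have h1 : ∀ b ∈ nbr Gᶜ X w, #(nbr G X u) - (t + 1) ≤
      #((nbr G X u).bipartiteAbove (fun b a => G.Adj b a) b) := by
    intro b hb
    have hbX : b ∈ X := (mem_nbr.1 hb).1
    have h2 := hr X u b (hu b hbX)
    have h3 : nbr G X u ⊆ (nbr G X u).bipartiteAbove (fun b a => G.Adj b a) b ∪
        insert b (excess G X u b) := by
      intro n
      simp only [nbr, excess, bipartiteAbove, mem_union, mem_insert, mem_filter]
      tauto
    have h4 := (card_le_card h3).trans (card_union_le _ _)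
    have h5 := card_insert_le b (excess G X u b)
    omega
  have h2 : ∀ a ∈ nbr G X u, #((nbr Gᶜ X w).bipartiteBelow (fun b a => G.Adj b a) a) ≤ t := by
    intro a ha
    refine le_trans (card_le_card ?_) (hr X a w (hw a (mem_nbr.1 ha).1))
    intro n
    simp only [nbr, excess, bipartiteBelow, mem_filter, SimpleGraph.compl_adj]
    rintro ⟨⟨h1, h2, h3⟩, h4⟩
    exact ⟨h1, h4.symm, h3, Ne.symm h2⟩
  have h3 := card_mul_le_card_mul _ h1 h2
  unfold lowDegree at hA hB
  obtain ⟨a, ha⟩ := Nat.exists_eq_add_of_le (show 2 * t + 2 ≤ #(nbr G X u) by nlinarith)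
  have hB' : 2 * t + 2 ≤ #(nbr Gᶜ X w) := by nlinarith
  rw [ha, show 2 * t + 2 + a - (t + 1) = t + 1 + a by omega] at h3
  nlinarith

/-- The vertices of `X` with the maximum allowed number of errors. -/
noncomputable def saturated (G : SimpleGraph V) (t : ℕ) (X I S : Finset V) : Finset V :=
  {x ∈ X | 4 * t ≤ #(nbr G (I ∪ S) x)}

/-- The vertices of `X` with no neighbour in `T`. -/
noncomputable def unblocked (G : SimpleGraph V) (X T : Finset V) : Finset V :=
  {x ∈ X | ∀ y ∈ T, ¬ G.Adj x y}

theorem card_compl_nbr_le {G : SimpleGraph V} {r : V → ℤ} {t : ℕ} (hr : IsRank G r t)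
    {X : Finset V} {w y : V} (hwy : r y ≤ r w) :
    #(nbr Gᶜ X w) ≤ #(nbr Gᶜ X y) + t + 1 := by
  have h1 : nbr Gᶜ X w ⊆ nbr Gᶜ X y ∪ insert y (excess G X y w) := by
    intro n
    simp only [nbr, excess, mem_union, mem_insert, mem_filter, SimpleGraph.compl_adj]
    grind
  have h2 := (card_le_card h1).trans (card_union_le _ _)
  have h3 := card_insert_le y (excess G X y w)
  have h4 := hr X y w hwy
  omega

theorem card_compl_nbr_filter_le {G : SimpleGraph V} {r : V → ℤ} {t : ℕ} (hr : IsRank G r t)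
    {X : Finset V} {y z : V} (hyz : r y ≤ r z) :
    #{a ∈ nbr Gᶜ X z | G.Adj y a} ≤ t := by
  refine le_trans (card_le_card ?_) (hr X y z hyz)
  intro n
  simp only [nbr, excess, mem_filter, SimpleGraph.compl_adj]
  grind

theorem card_saturated_le {G : SimpleGraph V} {r : V → ℤ} {t : ℕ} (ht : 1 ≤ t) (hr : IsRank G r t)
    {X I S B : Finset V} (h : Removed G r t X I S B) {w : V} (hw : ∀ x ∈ X, r x ≤ r w)
    (hwc : lowDegree t < #(nbr Gᶜ X w)) :
    #(saturated G t X I S) ≤ 10 * t + 10 := by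
  set T := saturated G t X I S
  have hTX : T ⊆ X := filter_subset _ _
  rcases T.eq_empty_or_nonempty with hempty | hne
  · simp [hempty]
  obtain ⟨y, hyT, hy⟩ := exists_min_image T r hne
  obtain ⟨z, hzT, hz⟩ := exists_max_image T r hne
  set P := nbr G (I ∪ S) y
  have hPcard : 4 * t ≤ #P := (mem_filter.1 hyT).2
  have hPX : ∀ p ∈ P, p ∉ X := by
    intro p hp hpX
    rcases mem_union.1 (mem_filter.1 hp).1 with hp' | hp'
    · exact disjoint_left.1 h.disjI hpX hp'
    · exact disjoint_left.1 h.disjS hpX hp'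
  obtain ⟨p, hpP, hp⟩ : ∃ p ∈ P, 4 * #{x ∈ T | ¬ G.Adj p x} ≤ #T := by
    by_contra! hcon
    have h1 : ∀ p ∈ P, #T / 4 + 1 ≤ #(T.bipartiteAbove (fun p x => ¬ G.Adj p x) p) := by
      intro p hp
      have := hcon p hp
      simp only [bipartiteAbove]
      omega
    have h2 : ∀ x ∈ T, #(P.bipartiteBelow (fun p x => ¬ G.Adj p x) x) ≤ t := by
      intro x hx
      refine le_trans (card_le_card ?_) (hr (I ∪ S) y x (hy x hx))
      intro n
      simp only [excess, bipartiteBelow, mem_filter]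
      rintro ⟨h1, h2⟩
      refine ⟨(mem_filter.1 h1).1, (mem_filter.1 h1).2, fun h3 => h2 h3.symm, ?_⟩
      rintro rfl
      exact hPX n h1 (hTX hx)
    have h3 := card_mul_le_card_mul _ h1 h2
    have h4 : #T < 4 * (#T / 4 + 1) := by omega
    nlinarith
  have hnear : ∀ x ∈ X, #{a ∈ T | ¬ G.Adj a x} ≤ #{x ∈ T | ¬ G.Adj p x} + (5 * t + 3) + 1 := by
    intro x hx
    have h1 := h.nearMin p (mem_filter.1 hpP).1 x hx
    have h2 : {a ∈ T | ¬ G.Adj a x} ⊆ {x ∈ T | ¬ G.Adj p x} ∪ insert x (excess G X p x) := by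
      intro n
      simp only [excess, mem_union, mem_insert, mem_filter, G.adj_comm n x]
      have := @hTX n
      tauto
    have h3 := (card_le_card h2).trans (card_union_le _ _)
    have h4 := card_insert_le x (excess G X p x)
    omega
  have hA := card_compl_nbr_le hr (X := X) (hw z (hTX hzT))
  have h1 : ∀ a ∈ nbr Gᶜ X z, #T - (#{x ∈ T | ¬ G.Adj p x} + (5 * t + 3) + 1) ≤
      #(T.bipartiteAbove (fun a x => G.Adj x a) a) := by
    intro a ha
    have h2 := hnear a (mem_nbr.1 ha).1
    have h3 := card_filter_add_card_filter_not (s := T) (fun x => G.Adj x a)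
    simp only [bipartiteAbove]
    omega
  have h2 : ∀ x ∈ T, #((nbr Gᶜ X z).bipartiteBelow (fun a x => G.Adj x a) x) ≤ t :=
    fun x hx => card_compl_nbr_filter_le hr (hz x hx)
  have h3 := card_mul_le_card_mul _ h1 h2
  by_contra! hcon
  have h4 : 4 * t ≤ #(nbr Gᶜ X z) := by
    unfold lowDegree at hwc
    nlinarith
  have h5 := (Nat.mul_le_mul_right (#T - (#{x ∈ T | ¬ G.Adj p x} + (5 * t + 3) + 1)) h4).trans h3
  have h6 : 4 * (#T - (#{x ∈ T | ¬ G.Adj p x} + (5 * t + 3) + 1)) ≤ #T := by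
    refine Nat.le_of_mul_le_mul_left ?_ ht
    linarith
  omega

theorem lt_card_unblocked {G : SimpleGraph V} {r : V → ℤ} {t : ℕ} (hr : IsRank G r t)
    {X T : Finset V} {w : V} (hw : ∀ x ∈ X, r x ≤ r w) (hTX : T ⊆ X)
    (hT : #T ≤ 10 * t + 10) (hwc : lowDegree t < #(nbr Gᶜ X w)) :
    2 * t + 1 < #(unblocked G X T) := by
  unfold lowDegree at hwc
  rcases T.eq_empty_or_nonempty with rfl | hne
  · have h1 : #(nbr Gᶜ X w) ≤ #(unblocked G X ∅) := by
      refine card_le_card fun n hn => ?_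
      simpa [unblocked] using (mem_nbr.1 hn).1
    nlinarith
  obtain ⟨z, hzT, hz⟩ := exists_max_image T r hne
  have h1 := card_compl_nbr_le hr (X := X) (hw z (hTX hzT))
  have h2 : nbr Gᶜ X z ⊆ unblocked G X T ∪ T.biUnion fun y => {a ∈ nbr Gᶜ X z | G.Adj y a} := by
    intro n hn
    simp only [unblocked, mem_union, mem_biUnion, mem_filter]
    by_cases hy : ∃ y ∈ T, G.Adj y n
    · obtain ⟨y, hyT, hyn⟩ := hy
      exact Or.inr ⟨y, hyT, hn, hyn⟩
    · push Not at hy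
      exact Or.inl ⟨(mem_nbr.1 hn).1, fun y hyT hny => hy y hyT hny.symm⟩
  have h3 := (card_le_card h2).trans (card_union_le _ _)
  have h4 : #(T.biUnion fun y => {a ∈ nbr Gᶜ X z | G.Adj y a}) ≤ #T * t :=
    card_biUnion_le_card_mul _ _ _ fun y hy => card_compl_nbr_filter_le hr (hz y hy)
  have h5 := Nat.mul_le_mul_right t hT
  nlinarith

/-- If the least-ranked unblocked vertex `v` has many neighbours not adjacent to the least-ranked
vertex `u`, then a vertex `x` without unblocked neighbours has few neighbours in `insert u S`. -/
theorem Removed.card_nbr_insert_le {G : SimpleGraph V} {r : V → ℤ} {t : ℕ} (hr : IsRank G r t)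
    {X I S B Q : Finset V} (h : Removed G r t X I S B) {u v x : V} (huX : u ∈ X)
    (hQ : 2 * t + 1 < #Q) (hv : ∀ q ∈ Q, r v ≤ r q) (hQx : ∀ q ∈ Q, ¬ G.Adj q x)
    (hvu : 4 * t + 2 < #(excess G X v u)) :
    #(nbr G (insert u S) x) ≤ 2 * t := by
  by_contra! hcon
  obtain ⟨P, hP, hPcard⟩ := exists_subset_card_eq (Nat.succ_le_of_lt hcon)
  have hPne : ∀ p ∈ P, ∀ n ∈ excess G X v u, n ≠ p := by
    rintro p hp n hn rfl
    have hn' := (mem_filter.1 hn)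
    rcases mem_insert.1 (mem_nbr.1 (hP hp)).1 with h1 | h1
    · exact hn'.2.2.2 h1
    · exact disjoint_left.1 h.disjS hn'.1 h1
  have hPdeg : ∀ p ∈ P, #{n ∈ excess G X v u | G.Adj p n} ≤ t := by
    intro p hp
    have hpu : r p ≤ r u := by
      rcases mem_insert.1 (mem_nbr.1 (hP hp)).1 with rfl | h1
      · exact le_rfl
      · exact h.rankS p h1 u huX
    refine le_trans (card_le_card ?_) (hr X p u hpu)
    intro n
    simp only [excess, mem_filter]
    tauto
  set M := {n ∈ excess G X v u | t + 1 ≤ #{p ∈ P | G.Adj p n}}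
  have hMcard : #M ≤ 2 * t := by
    have h1 : ∀ n ∈ M, t + 1 ≤ #(P.bipartiteAbove (fun n p => G.Adj p n) n) :=
      fun n hn => (mem_filter.1 hn).2
    have h2 : ∀ p ∈ P, #(M.bipartiteBelow (fun n p => G.Adj p n) p) ≤ t := fun p hp =>
      (card_le_card (filter_subset_filter _ (filter_subset _ _))).trans (hPdeg p hp)
    have h3 := card_mul_le_card_mul _ h1 h2
    rw [hPcard] at h3
    by_contra! h4
    have h5 := Nat.mul_le_mul_right (t + 1) (Nat.succ_le_of_lt h4)
    simp only [Nat.succ_eq_add_one] at h5 h3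
    nlinarith
  set N := (excess G X v u \ M).erase x
  have hNcard : 2 * t + 2 ≤ #N := by
    have h1 := le_card_sdiff M (excess G X v u)
    have h2 : #(excess G X v u \ M) - 1 ≤ #N := pred_card_le_card_erase
    omega
  have hNdeg : ∀ n ∈ N, #{q ∈ Q.erase x | G.Adj q n} ≤ t := by
    intro n hn
    obtain ⟨hnx, hn'⟩ := mem_erase.1 hn
    obtain ⟨hn1, hnM⟩ := mem_sdiff.1 hn'
    have hn2 : #{p ∈ P | G.Adj p n} ≤ t := by
      by_contra! h1
      exact hnM (mem_filter.2 ⟨hn1, h1⟩)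
    have h1 : #{p ∈ P | ¬ G.Adj p n} ≤ #(excess G P x n) := by
      refine card_le_card fun p hp => ?_
      obtain ⟨hpP, hpn⟩ := mem_filter.1 hp
      exact mem_filter.2 ⟨hpP, (mem_nbr.1 (hP hpP)).2, fun h => hpn h.symm,
        (hPne p hpP n hn1).symm⟩
    have h2 := card_filter_add_card_filter_not (s := P) (fun p => G.Adj p n)
    have h3 : r n ≤ r x := by
      by_contra! h4
      have := hr P x n h4.le
      omega
    refine le_trans (card_le_card ?_) (hr Q n x h3)
    intro q hq
    obtain ⟨hq1, hqn⟩ := mem_filter.1 hq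
    obtain ⟨hqx, hqQ⟩ := mem_erase.1 hq1
    exact mem_filter.2 ⟨hqQ, hqn.symm, fun h => hQx q hqQ h.symm, hqx⟩
  have hQdeg : ∀ q ∈ Q.erase x, #N - (t + 1) ≤ #(N.bipartiteAbove (fun q n => G.Adj q n) q) := by
    intro q hq
    have hqQ := mem_of_mem_erase hq
    have h1 : N ⊆ N.bipartiteAbove (fun q n => G.Adj q n) q ∪ insert q (excess G X v q) := by
      intro n hn
      have h2 := mem_filter.1 (mem_sdiff.1 (mem_of_mem_erase hn)).1
      simp only [bipartiteAbove, excess, mem_union, mem_insert, mem_filter]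
      tauto
    have h2 := (card_le_card h1).trans (card_union_le _ _)
    have h3 := card_insert_le q (excess G X v q)
    have h4 := hr X v q (hv q hqQ)
    omega
  have h1 := card_mul_le_card_mul _ hQdeg hNdeg
  have h2 : 2 * t + 1 ≤ #(Q.erase x) := by
    have := pred_card_le_card_erase (s := Q) (a := x)
    omega
  obtain ⟨a, ha⟩ := Nat.exists_eq_add_of_le hNcard
  rw [ha, show 2 * t + 2 + a - (t + 1) = t + 1 + a by omega] at h1
  nlinarith

theorem Removed.insert_isolated {G : SimpleGraph V} {r : V → ℤ} {t : ℕ} {X I S B : Finset V}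
    (h : Removed G r t X I S B) {v : V} (hv : v ∈ X)
    (hnear : ∀ x ∈ X, #(excess G X v x) ≤ 5 * t + 3)
    (hcard : ∀ x ∈ X, G.Adj x v → #(nbr G I x) < 4 * t) :
    Removed G r t (X.erase v) (insert v I) S B :=
  { h.mono (erase_subset v X) with
    disjI := by
      rw [disjoint_insert_right]
      exact ⟨notMem_erase v X, h.disjI.mono_left (erase_subset v X)⟩
    nearMin := by
      intro y hy x hx
      rw [insert_union] at hy
      refine (excess_mono G (erase_subset v X) y x).trans ?_
      rcases mem_insert.1 hy with rfl | hy
      · exact hnear x (mem_of_mem_erase hx)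
      · exact h.nearMin y hy x (mem_of_mem_erase hx)
    cardI := by
      intro x hx
      have hxX := mem_of_mem_erase hx
      rw [card_nbr_insert (disjoint_left.1 h.disjI hv)]
      split_ifs with hadj
      · exact hcard x hxX hadj
      · exact h.cardI x hxX }

theorem Removed.insert_min {G : SimpleGraph V} {r : V → ℤ} {t : ℕ} (hr : IsRank G r t)
    {X I S B : Finset V} (h : Removed G r t X I S B) {u : V} (huX : u ∈ X)
    (hu : ∀ x ∈ X, r u ≤ r x) (hcard : ∀ x ∈ X, #(nbr G (insert u S) x) ≤ 4 * t) :
    Removed G r t (X.erase u) I (insert u S) B :=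
  { h.mono (erase_subset u X) with
    disjS := by
      rw [disjoint_insert_right]
      exact ⟨notMem_erase u X, h.disjS.mono_left (erase_subset u X)⟩
    nearMin := by
      intro y hy x hx
      rw [union_insert] at hy
      refine (excess_mono G (erase_subset u X) y x).trans ?_
      rcases mem_insert.1 hy with rfl | hy
      · exact (hr X y x (hu x (mem_of_mem_erase hx))).trans (by omega)
      · exact h.nearMin y hy x (mem_of_mem_erase hx)
    rankS := by
      intro y hy x hx
      rcases mem_insert.1 hy with rfl | hy
      · exact hu x (mem_of_mem_erase hx)
      · exact h.rankS y hy x (mem_of_mem_erase hx)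
    cardS := fun x hx => hcard x (mem_of_mem_erase hx) }

/-- If the least-ranked vertex is almost isolated and the greatest-ranked one is not almost
dominating, then some almost isolated vertex can be removed. -/
theorem Removed.exists_removable {G : SimpleGraph V} {r : V → ℤ} {t : ℕ} (ht : 1 ≤ t)
    (hr : IsRank G r t) {X I S B : Finset V} (h : Removed G r t X I S B) {u w : V} (huX : u ∈ X)
    (hu : ∀ x ∈ X, r u ≤ r x) (hw : ∀ x ∈ X, r x ≤ r w) (hlow : #(nbr G X u) ≤ lowDegree t)
    (hwc : lowDegree t < #(nbr Gᶜ X w)) :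
    ∃ v ∈ X, #(nbr G X v) ≤ lowDegree t + 4 * t + 3 ∧
      (Removed G r t (X.erase v) (insert v I) S B ∨
        Removed G r t (X.erase v) I (insert v S) B) := by
  have hT := card_saturated_le ht hr h hw hwc
  have hQ : 2 * t + 1 < #(unblocked G X (saturated G t X I S)) :=
    lt_card_unblocked hr hw (filter_subset _ _) hT hwc
  have hQX : unblocked G X (saturated G t X I S) ⊆ X := filter_subset _ _
  have hQT : ∀ x ∈ saturated G t X I S, ∀ q ∈ unblocked G X (saturated G t X I S), ¬ G.Adj q x :=
    fun x hx q hq => (mem_filter.1 hq).2 x hx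
  have hunsat : ∀ x ∈ X, x ∉ saturated G t X I S → #(nbr G (I ∪ S) x) < 4 * t := by
    intro x hx hxT
    by_contra! h1
    exact hxT (mem_filter.2 ⟨hx, h1⟩)
  obtain ⟨v, hvQ, hv⟩ := exists_min_image _ r (card_pos.1 (pos_of_gt hQ))
  by_cases hvu : #(excess G X v u) ≤ 4 * t + 2
  · refine ⟨v, hQX hvQ, ?_, Or.inl (h.insert_isolated (hQX hvQ) ?_ ?_)⟩
    · have h1 : nbr G X v ⊆ nbr G X u ∪ insert u (excess G X v u) := by
        intro n
        simp only [nbr, excess, mem_union, mem_insert, mem_filter]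
        tauto
      have h2 := (card_le_card h1).trans (card_union_le _ _)
      have h3 := card_insert_le u (excess G X v u)
      omega
    · intro x hx
      have h1 : excess G X v x ⊆ excess G X u x ∪ insert u (excess G X v u) := by
        intro n
        simp only [excess, mem_union, mem_insert, mem_filter]
        tauto
      have h2 := (card_le_card h1).trans (card_union_le _ _)
      have h3 := card_insert_le u (excess G X v u)
      have h4 := hr X u x (hu x hx)
      omega
    · intro x hx hadj
      have hxT : x ∉ saturated G t X I S := fun hxT => hQT x hxT v hvQ hadj.symm
      exact (nbr_mono G subset_union_left x).trans_lt (hunsat x hx hxT)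
  · refine ⟨u, huX, by omega, Or.inr (h.insert_min hr huX hu ?_)⟩
    intro x hx
    by_cases hxT : x ∈ saturated G t X I S
    · have := h.card_nbr_insert_le hr huX hQ hv (hQT x hxT) (not_le.1 hvu)
      omega
    · have h1 := (nbr_mono G subset_union_right x).trans_lt (hunsat x hx hxT)
      rw [card_nbr_insert (disjoint_left.1 h.disjS huX)]
      split_ifs <;> omega

/-- Removing an almost isolated vertex `u` together with a vertex `w` of greatest rank. -/
theorem Removed.insert_paired {G : SimpleGraph V} {r : V → ℤ} {t : ℕ} (ht : 1 ≤ t)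
    (hr : IsRank G r t) {X I S B : Finset V} (h : Removed G r t X I S B) {u w : V} (huX : u ∈ X)
    (hwX : w ∈ X) (hw : ∀ x ∈ X, r x ≤ r w) (hlow : #(nbr G X u) ≤ lowDegree t) :
    Removed G r t ((X.erase u).erase w) I S (insert u B) := by
  have hsub : (X.erase u).erase w ⊆ X := (erase_subset _ _).trans (erase_subset _ _)
  have huB : u ∉ B := disjoint_left.1 h.disjB huX
  refine { h.mono hsub with disjB := ?_, degB := ?_, cardB := ?_ }
  · rw [disjoint_insert_right]
    exact ⟨by simp, h.disjB.mono_left hsub⟩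
  · intro b hb
    refine (nbr_mono G hsub b).trans ?_
    rcases mem_insert.1 hb with rfl | hb
    · exact hlow
    · exact h.degB b hb
  · intro x hx
    have hxX := hsub hx
    have hdrop : #{y ∈ (X.erase u).erase w | r x ≤ r y} < #{y ∈ X | r x ≤ r y} := by
      refine card_lt_card ((filter_subset_filter _ hsub).ssubset_of_mem_notMem
        (mem_filter.2 ⟨hwX, hw x hxX⟩) ?_)
      simp
    have hins : #(nbr G (insert u B) x) ≤ #(nbr G B x) + 1 := by
      rw [card_nbr_insert huB]
      split_ifs <;> omega
    rcases h.cardB x hxX with h1 | h1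
    · rcases h1.lt_or_eq with h1 | h1
      · left; omega
      right
      have h2 : ∀ y ∈ ({y ∈ X | r x ≤ r y} : Finset V),
          t ≤ #((nbr G B x).bipartiteAbove (fun y p => G.Adj p y) y) := by
        intro y hy
        obtain ⟨hyX, hxy⟩ := mem_filter.1 hy
        have h3 : nbr G B x ⊆
            (nbr G B x).bipartiteAbove (fun y p => G.Adj p y) y ∪ excess G B x y := by
          intro p hp
          have hpy : p ≠ y := by
            rintro rfl
            exact disjoint_left.1 h.disjB hyX (mem_nbr.1 hp).1
          have := mem_nbr.1 hp
          simp only [excess, bipartiteAbove, mem_union, mem_filter, G.adj_comm y p]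
          tauto
        have h4 := (card_le_card h3).trans (card_union_le _ _)
        have h5 := hr B x y hxy
        omega
      have h3 : ∀ p ∈ nbr G B x,
          #(({y ∈ X | r x ≤ r y} : Finset V).bipartiteBelow (fun y p => G.Adj p y) p) ≤
            lowDegree t := fun p hp =>
        (card_le_card (filter_subset_filter _ (filter_subset _ _))).trans
          (h.degB p (mem_nbr.1 hp).1)
      have h4 := card_mul_le_card_mul _ h2 h3
      rw [h1] at h4
      have h5 : #{y ∈ X | r x ≤ r y} ≤ 2 * lowDegree t := by
        refine Nat.le_of_mul_le_mul_left ?_ ht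
        linarith
      omega
    · right; omega

theorem errors_insert_isolated {G : SimpleGraph V} {I S B : Finset V} {v : V} (hv : v ∉ I)
    (x : V) : errors G (insert v I) S B x = errors G I S B x + if G.Adj x v then 1 else 0 := by
  unfold errors
  rw [card_nbr_insert hv]
  omega

theorem errors_insert_min {G : SimpleGraph V} {I S B : Finset V} {v : V} (hv : v ∉ S)
    (x : V) : errors G I (insert v S) B x = errors G I S B x + if G.Adj x v then 1 else 0 := by
  unfold errors
  rw [card_nbr_insert hv]
  omega

theorem errors_insert_paired {G : SimpleGraph V} {I S B : Finset V} {v : V} (hv : v ∉ B)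
    (x : V) : errors G I S (insert v B) x = errors G I S B x + if G.Adj x v then 1 else 0 := by
  unfold errors
  rw [card_nbr_insert hv]
  omega

/-- The removal process: every graph whose removed vertices satisfy the invariants, on both sides,
is close to a nested one. -/
theorem approximable {t : ℕ} (ht : 1 ≤ t) (n : ℕ) :
    ∀ (G : SimpleGraph V) (r : V → ℤ) (X I S B J R C : Finset V), #X ≤ n → IsRank G r t →
      Removed G r t X I S B → Removed Gᶜ (fun v => - r v) t X J R C →
      Approximable G X (fun x => errors G I S B x + errors Gᶜ J R C x)
        (24 * t + 5 * lowDegree t + 3) := by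
  induction n with
  | zero =>
    intro G r X I S B J R C hX _ _ _
    have hX' : X = ∅ := by simpa using hX
    subst hX'
    exact ⟨⊥, by simp [Nested], by simp⟩
  | succ n ih =>
    have key : ∀ (G : SimpleGraph V) (r : V → ℤ) (X I S B J R C : Finset V), #X ≤ n + 1 →
        IsRank G r t → Removed G r t X I S B → Removed Gᶜ (fun v => - r v) t X J R C →
        ∀ u w, u ∈ X → (∀ x ∈ X, r u ≤ r x) → (∀ x ∈ X, r x ≤ r w) →
        #(nbr G X u) ≤ lowDegree t → lowDegree t < #(nbr Gᶜ X w) →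
        Approximable G X (fun x => errors G I S B x + errors Gᶜ J R C x)
          (24 * t + 5 * lowDegree t + 3) := by
      intro G r X I S B J R C hX hr h h' u w huX hu hw hlow hwc
      obtain ⟨v, hvX, hvdeg, hv⟩ := h.exists_removable ht hr huX hu hw hlow hwc
      have hcard : #(X.erase v) ≤ n := by
        rw [card_erase_of_mem hvX]
        omega
      have h1 := h.errors_le hvX
      have h2 := h'.errors_le hvX
      rcases hv with hv | hv
      · refine (ih G r _ _ _ _ _ _ _ hcard hr hv (h'.mono (erase_subset v X))).of_erase
          (fun x _ => ?_) (by omega)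
        rw [errors_insert_isolated (disjoint_left.1 h.disjI hvX)]
        omega
      · refine (ih G r _ _ _ _ _ _ _ hcard hr hv (h'.mono (erase_subset v X))).of_erase
          (fun x _ => ?_) (by omega)
        rw [errors_insert_min (disjoint_left.1 h.disjS hvX)]
        omega
    intro G r X I S B J R C hX hr h h'
    by_cases hX1 : #X ≤ 1
    · refine ⟨⊥, fun _ _ _ _ => by simp, fun x hx => ?_⟩
      have h1 := h.errors_le hx
      have h2 := h'.errors_le hx
      have h3 := card_le_card (diff_subset G ⊥ X x)
      dsimp only
      omega
    have hne : X.Nonempty := card_pos.1 (by omega)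
    obtain ⟨u, huX, hu⟩ := exists_min_image X r hne
    have hne' : (X.erase u).Nonempty := by
      refine card_pos.1 ?_
      rw [card_erase_of_mem huX]
      omega
    obtain ⟨w, hwX', hw'⟩ := exists_max_image (X.erase u) r hne'
    have hwX := mem_of_mem_erase hwX'
    have hw : ∀ x ∈ X, r x ≤ r w := by
      intro x hx
      by_cases hxu : x = u
      · subst hxu; exact hu w hwX
      · exact hw' x (mem_erase.2 ⟨hxu, hx⟩)
    by_cases hlow : #(nbr G X u) ≤ lowDegree t
    · by_cases hwlow : #(nbr Gᶜ X w) ≤ lowDegree t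
      · have hcard : #((X.erase u).erase w) ≤ n := by
          rw [card_erase_of_mem hwX', card_erase_of_mem huX]
          omega
        have hG := h.insert_paired ht hr huX hwX hw hlow
        have hGc := h'.insert_paired ht hr.compl hwX huX (fun x hx => neg_le_neg (hu x hx)) hwlow
        rw [erase_right_comm] at hGc
        have h1 := h.errors_le huX
        have h2 := h'.errors_le huX
        have h3 := h.errors_le hwX
        have h4 := h'.errors_le hwX
        have h5 := nbr_mono Gᶜ (erase_subset u X) w
        have step : Approximable G (X.erase u)
            (fun x => errors G I S B x + errors Gᶜ J R C x + if G.Adj x u then 1 else 0)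
            (24 * t + 5 * lowDegree t + 3) := by
          refine Approximable.of_compl
            ((ih G r _ _ _ _ _ _ _ hcard hr hG hGc).compl.of_erase (fun x _ => ?_) ?_)
          · rw [errors_insert_paired (disjoint_left.1 h.disjB huX),
              errors_insert_paired (disjoint_left.1 h'.disjB hwX)]
            omega
          · split_ifs <;> omega
        exact step.of_erase (fun x _ => le_rfl) (by omega)
      · exact key G r X I S B J R C hX hr h h' u w huX hu hw hlow (not_le.1 hwlow)
    · have hwlow := (low_or_low hr hu hw).resolve_left hlow
      have := key Gᶜ (fun v => - r v) X J R C I S B hX hr.compl h' (by simpa using h) w u hwX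
        (fun x hx => neg_le_neg (hw x hx)) (fun x hx => neg_le_neg (hu x hx)) hwlow
        (by simpa using hlow)
      refine Approximable.of_compl ?_
      simpa [add_comm] using this

theorem isRank_degree [Fintype V] {G : SimpleGraph V} {t : ℕ} (hG : IsTDominating G t) :
    IsRank G (fun v => (#(nbr G univ v) : ℤ)) t := by
  have hdom : ∀ x y, Dominates G t y x → #(excess G univ x y) ≤ t := by
    intro x y h
    refine le_trans (le_of_eq ?_) h
    rw [← Set.ncard_coe_finset]
    congr 1
    ext n
    simp only [excess, coe_filter, mem_univ, true_and, Set.mem_ofPred_eq, G.adj_comm n]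
    constructor
    · rintro ⟨h1, h2, h3⟩
      exact ⟨h3, h1.ne', h1, h2⟩
    · rintro ⟨h1, -, h2, h3⟩
      exact ⟨h2, h3, h1⟩
  have hsplit : ∀ x y, #(nbr G univ x) =
      #(excess G univ x y) + #{n | G.Adj x n ∧ G.Adj y n} + if G.Adj x y then 1 else 0 := by
    intro x y
    have h1 := card_filter_add_card_filter_not (s := nbr G univ x) (fun n => G.Adj y n)
    have h2 := card_filter_add_card_filter_not (s := {n ∈ nbr G univ x | ¬ G.Adj y n})
      (fun n => n = y)
    have h3 : #{n ∈ {n ∈ nbr G univ x | ¬ G.Adj y n} | n = y} = if G.Adj x y then 1 else 0 := by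
      split_ifs with h
      · refine card_eq_one.2 ⟨y, ?_⟩
        ext n
        simp only [nbr, mem_filter, mem_univ, true_and, mem_singleton]
        exact ⟨fun h => h.2, by rintro rfl; exact ⟨⟨h, G.irrefl⟩, rfl⟩⟩
      · refine card_eq_zero.2 (filter_eq_empty_iff.2 ?_)
        rintro n hn rfl
        exact h (mem_nbr.1 (mem_filter.1 hn).1).2
    have h4 : ({n ∈ {n ∈ nbr G univ x | ¬ G.Adj y n} | ¬ n = y} : Finset V) =
        excess G univ x y := by
      ext n
      simp only [nbr, excess, mem_filter]
      tauto
    have h5 : ({n ∈ nbr G univ x | G.Adj y n} : Finset V) =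
        ({n | G.Adj x n ∧ G.Adj y n} : Finset V) := by
      ext n
      simp [nbr]
    rw [h4] at h2
    rw [h5] at h1
    omega
  intro X x y hxy
  refine (excess_mono G (subset_univ X) x y).trans ?_
  by_cases hne : x = y
  · subst hne
    rw [excess, filter_false_of_mem (fun n _ h => h.2.1 h.1)]
    simp
  rcases hG x y hne with h | h
  · have h1 := hdom y x h
    have h2 := hsplit x y
    have h3 := hsplit y x
    simp only [and_comm (a := G.Adj y _), G.adj_comm y x] at h3
    simp only [Nat.cast_le] at hxy
    omega
  · exact hdom x y h

theorem Nested.isTDominating [Fintype V] {H : SimpleGraph V} (h : Nested H univ) :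
    IsTDominating H 0 := by
  intro u v _
  have hempty : ∀ x y, (∀ w, w ≠ x → w ≠ y → H.Adj w y → H.Adj w x) → Dominates H 0 x y := by
    intro x y hxy
    refine ((congrArg Set.ncard (Set.eq_empty_of_forall_notMem ?_)).trans (Set.ncard_empty V)).le
    rintro w ⟨h1, h2, h3, h4⟩
    exact h4 (hxy w h1 h2 h3)
  rcases h u (mem_univ u) v (mem_univ v) with h | h
  · exact Or.inl (hempty u v fun w => h w (mem_univ w))
  · exact Or.inr (hempty v u fun w h1 h2 => h w (mem_univ w) h2 h1)

theorem localDiffLE_of_card_diff_le [Fintype V] {G H : SimpleGraph V} {d : ℕ}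
    (h : ∀ x, #(diff G H univ x) ≤ d) : LocalDiffLE G H d := by
  intro v
  rw [← Set.ncard_union_eq (by grind)]
  refine le_trans (le_of_eq ?_) (h v)
  rw [← Set.ncard_coe_finset]
  congr 1
  ext n
  simp only [diff, coe_filter, mem_univ, true_and, Set.mem_ofPred_eq, Set.mem_union, Set.mem_sdiff,
    SimpleGraph.mem_neighborSet]
  tauto

theorem Removed.of_empty (G : SimpleGraph V) (r : V → ℤ) (t : ℕ) (X : Finset V) :
    Removed G r t X ∅ ∅ ∅ := by
  constructor <;> simp [nbr]

end ThresholdApprox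

open ThresholdApprox in
theorem statement_0 {V : Type*} [Fintype V] (t : ℕ) (G : SimpleGraph V)
    (hG : IsTDominating G t) :
    ∃ H : SimpleGraph V, IsTDominating H 0 ∧ LocalDiffLE G H (646 * t ^ 4) := by
  rcases Nat.eq_zero_or_pos t with rfl | ht
  · exact ⟨G, hG, fun v => by simp⟩
  obtain ⟨H, hN, hH⟩ := approximable ht _ G _ Finset.univ ∅ ∅ ∅ ∅ ∅ ∅ le_rfl (isRank_degree hG)
    (Removed.of_empty ..) (Removed.of_empty ..)
  refine ⟨H, hN.isTDominating, localDiffLE_of_card_diff_le fun x => ?_⟩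
  have h1 := hH x (Finset.mem_univ x)
  have h2 : t ≤ t ^ 2 := by nlinarith
  have h3 : t ^ 2 ≤ t ^ 4 := Nat.pow_le_pow_right ht (by norm_num)
  unfold lowDegree at h1
  omega
end

section
/- A graph is 0-dominating if and only if it has no induced subgraph isomorphic to C₄ (the four-vertex cycle), 2K₂ (the disjoint union of two edges), or P₄ (the four-vertex path). -/
/-- The graph `2K₂`: two disjoint edges on four vertices. -/
def twoK2 : SimpleGraph (Fin 4) :=
  SimpleGraph.fromRel (fun i j => (i = 0 ∧ j = 1) ∨ (i = 2 ∧ j = 3))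

/-- A graph is `0`-dominating iff it has no alternating four-cycle: edges `ux`, `vw` together with
non-edges `uw`, `vx`, on four distinct vertices. -/
theorem isTDominating_zero_iff {V : Type*} [Finite V] (G : SimpleGraph V) :
    IsTDominating G 0 ↔ ∀ u v w x : V, u ≠ v → w ≠ u → x ≠ v → G.Adj u x → G.Adj v w →
      ¬ G.Adj u w → G.Adj v x := by
  have key (u v : V) : Dominates G 0 u v ↔ ∀ w, w ≠ u → G.Adj v w → G.Adj u w := by
    rw [Dominates, Nat.le_zero, Set.ncard_eq_zero (Set.toFinite _), Set.eq_empty_iff_forall_notMem]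
    refine forall_congr' fun w => ?_
    have h : G.Adj v w → w ≠ v := fun h => h.ne'
    simp only [Set.mem_ofPred_eq, G.adj_comm w]
    tauto
  simp only [IsTDominating, key]
  constructor
  · intro h u v w x huv hw hx hux hvw huw
    rcases h u v huv with h | h
    · exact absurd (h w hw hvw) huw
    · exact h x hx hux
  · intro h u v huv
    by_contra! hc
    obtain ⟨⟨w, hw, hvw, huw⟩, x, hx, hux, hvx⟩ := hc
    exact hvx (h u v w x huv hw hx hux hvw huw)

/-- An induced copy of a graph on `Fin 4` from four distinct vertices with matching adjacencies. -/
theorem nonempty_embedding_fin_four {V : Type*} {G : SimpleGraph V} {H : SimpleGraph (Fin 4)}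
    {a b c d : V} (hab : a ≠ b) (hac : a ≠ c) (had : a ≠ d) (hbc : b ≠ c) (hbd : b ≠ d)
    (hcd : c ≠ d) (ab : G.Adj a b ↔ H.Adj 0 1) (ac : G.Adj a c ↔ H.Adj 0 2)
    (ad : G.Adj a d ↔ H.Adj 0 3) (bc : G.Adj b c ↔ H.Adj 1 2) (bd : G.Adj b d ↔ H.Adj 1 3)
    (cd : G.Adj c d ↔ H.Adj 2 3) : Nonempty (H ↪g G) := by
  refine ⟨⟨⟨![a, b, c, d], ?_⟩, ?_⟩⟩
  · intro i j
    fin_cases i <;> fin_cases j <;>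
      simp [*, hab.symm, hac.symm, had.symm, hbc.symm, hbd.symm, hcd.symm]
  · intro i j
    change G.Adj (![a, b, c, d] i) (![a, b, c, d] j) ↔ H.Adj i j
    fin_cases i <;> fin_cases j <;>
      simp [*, G.adj_comm b a, G.adj_comm c a, G.adj_comm d a, G.adj_comm c b, G.adj_comm d b,
        G.adj_comm d c, H.adj_comm 1 0, H.adj_comm 2 0, H.adj_comm 3 0, H.adj_comm 2 1,
        H.adj_comm 3 1, H.adj_comm 3 2]

theorem statement_1 {V : Type*} [Fintype V] (G : SimpleGraph V) :
    IsTDominating G 0 ↔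
      ¬ Nonempty (SimpleGraph.cycleGraph 4 ↪g G) ∧
      ¬ Nonempty (twoK2 ↪g G) ∧
      ¬ Nonempty (SimpleGraph.pathGraph 4 ↪g G) := by
  rw [isTDominating_zero_iff]
  constructor
  · intro h
    refine ⟨?_, ?_, ?_⟩ <;> rintro ⟨f⟩
    · have := h (f 0) (f 3) (f 2) (f 1)
      simp [f.map_adj_iff, f.injective.eq_iff, SimpleGraph.cycleGraph_adj'] at this
      revert this; decide
    · have := h (f 0) (f 2) (f 3) (f 1)
      simp only [f.map_adj_iff, f.injective.ne_iff] at this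
      simp [twoK2] at this
    · have := h (f 1) (f 2) (f 3) (f 0)
      simp [f.map_adj_iff, f.injective.eq_iff, SimpleGraph.pathGraph_adj] at this
  · rintro ⟨hC, hK, hP⟩ u v w x huv hw hx hux hvw huw
    by_contra hvx
    have hwx : w ≠ x := by rintro rfl; exact huw hux
    have hxv : ¬ G.Adj x v := fun h => hvx h.symm
    have hwu : ¬ G.Adj w u := fun h => huw h.symm
    by_cases huv' : G.Adj u v <;> by_cases hxw : G.Adj x w
    · refine hC (nonempty_embedding_fin_four (a := u) (b := x) (c := w) (d := v) hux.ne hw.symm huv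
        hwx.symm hx hvw.ne' ?_ ?_ ?_ ?_ ?_ ?_) <;>
        simp [*, hvw.symm, SimpleGraph.cycleGraph_adj'] <;> decide
    · refine hP (nonempty_embedding_fin_four (a := x) (b := u) (c := v) (d := w) hux.ne' hx hwx.symm
        huv hw.symm hvw.ne ?_ ?_ ?_ ?_ ?_ ?_) <;>
        simp [*, hux.symm, SimpleGraph.pathGraph_adj]
    · refine hP (nonempty_embedding_fin_four (a := u) (b := x) (c := w) (d := v) hux.ne hw.symm huv
        hwx.symm hx hvw.ne' ?_ ?_ ?_ ?_ ?_ ?_) <;>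
        simp [*, hvw.symm, SimpleGraph.pathGraph_adj]
    · refine hK (nonempty_embedding_fin_four (a := u) (b := x) (c := v) (d := w) hux.ne huv hw.symm
        hx hwx.symm hvw.ne ?_ ?_ ?_ ?_ ?_ ?_) <;>
        simp [*, twoK2]
end

section
/- A graph is 0-dominating if and only if it is a split half-graph. -/
/-- `H` is a split half-graph: the vertex set is partitioned into a clique `X` and a stable
set `Y`, and `X` and `Y` can be ordered so that the edges between `X` and `Y` form a
half-graph. -/
def IsSplitHalfGraph {V : Type*} (H : SimpleGraph V) : Prop :=
  ∃ X Y : Set V, (∀ v, v ∈ X ∨ v ∈ Y) ∧ Disjoint X Y ∧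
    (∀ x ∈ X, ∀ x' ∈ X, x ≠ x' → H.Adj x x') ∧
    (∀ y ∈ Y, ∀ y' ∈ Y, ¬ H.Adj y y') ∧
    ∃ f : V → ℕ, Set.InjOn f X ∧ Set.InjOn f Y ∧
      ∀ x ∈ X, ∀ x' ∈ X, ∀ y ∈ Y, ∀ y' ∈ Y,
        f x ≤ f x' → f y ≤ f y' → H.Adj x y → H.Adj x' y'

theorem dominates_zero_iff {V : Type*} [Finite V] (G : SimpleGraph V) (u v : V) :
    Dominates G 0 u v ↔ ∀ w, w ≠ u → G.Adj w v → G.Adj w u := by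
  rw [Dominates, Nat.le_zero, Set.ncard_eq_zero (Set.toFinite _), Set.eq_empty_iff_forall_notMem]
  refine forall_congr' fun w => ⟨fun h hwu hwv => ?_, fun h hw => hw.2.2.2 (h hw.1 hw.2.2.1)⟩
  by_contra hn
  exact h ⟨hwu, hwv.ne, hwv, hn⟩

/-- In a `0`-dominating graph, a vertex dominates every other vertex of at most its degree. -/
theorem IsTDominating.dominates_of_degree_le {V : Type*} [Fintype V] {G : SimpleGraph V}
    [DecidableRel G.Adj] (h : IsTDominating G 0) {u v : V} (huv : u ≠ v)
    (hd : G.degree v ≤ G.degree u) : Dominates G 0 u v := by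
  classical
  rcases h u v huv with h | h
  · exact h
  rw [dominates_zero_iff] at h ⊢
  have hsub : (G.neighborFinset u).erase v ⊆ (G.neighborFinset v).erase u := by
    intro w hw
    simp only [Finset.mem_erase, SimpleGraph.mem_neighborFinset] at hw ⊢
    exact ⟨hw.2.ne', (h w hw.1 hw.2.symm).symm⟩
  have hcard : ((G.neighborFinset v).erase u).card ≤ ((G.neighborFinset u).erase v).card := by
    simp only [Finset.card_erase_eq_ite, SimpleGraph.mem_neighborFinset,
      SimpleGraph.card_neighborFinset_eq_degree, G.adj_comm v u]
    split_ifs <;> omega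
  intro w hwu hwv
  have hw : w ∈ (G.neighborFinset v).erase u := by
    simpa using ⟨hwu, hwv.symm⟩
  rw [← Finset.eq_of_subset_of_card_le hsub hcard] at hw
  simp only [Finset.mem_erase, SimpleGraph.mem_neighborFinset] at hw
  exact hw.2.symm

theorem exists_injective_nat_monotone_along {V : Type*} [Finite V] (d : V → ℕ) :
    ∃ r : V → ℕ, Function.Injective r ∧ ∀ u v, r u ≤ r v → d u ≤ d v := by
  obtain ⟨n, ⟨e⟩⟩ := Finite.exists_equiv_fin V
  have hdiv (v : V) : (n * d v + e v) / n = d v := by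
    rw [Nat.mul_add_div (e v).pos, Nat.div_eq_of_lt (e v).isLt, add_zero]
  have hmod (v : V) : (n * d v + e v) % n = e v := by
    rw [Nat.mul_add_mod, Nat.mod_eq_of_lt (e v).isLt]
  refine ⟨fun v => n * d v + e v, fun u v huv => e.injective (Fin.ext ?_), fun u v huv => ?_⟩
  · rw [← hmod u, ← hmod v]
    exact congrArg (· % n) huv
  · rw [← hdiv u, ← hdiv v]
    exact Nat.div_le_div_right huv

theorem IsTDominating.isSplitHalfGraph {V : Type*} [Fintype V] {G : SimpleGraph V}
    (h : IsTDominating G 0) : IsSplitHalfGraph G := by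
  classical
  obtain ⟨r, hr, hrd⟩ := exists_injective_nat_monotone_along (fun v => G.degree v)
  have dom {u v w : V} (hvu : r v ≤ r u) (hwu : w ≠ u) (hwv : G.Adj w v) : G.Adj w u := by
    by_cases huv : u = v
    · exact huv ▸ hwv
    · exact (dominates_zero_iff G u v).1 (h.dominates_of_degree_le huv (hrd v u hvu)) w hwu hwv
  let X : Set V := {v | ∃ w, r w < r v ∧ G.Adj v w}
  have clique {x x' : V} (hx : x ∈ X) (hlt : r x < r x') : G.Adj x' x := by
    obtain ⟨w, hw, hxw⟩ := hx
    have hwx' : w ≠ x' := by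
      rintro rfl
      omega
    have hne : x' ≠ x := by
      rintro rfl
      omega
    exact dom hw.le hne (dom hlt.le hwx' hxw.symm).symm
  have stable {y y' : V} (hy' : y' ∈ Xᶜ) (hlt : r y < r y') : ¬ G.Adj y' y :=
    fun hadj => hy' ⟨y, hlt, hadj⟩
  refine ⟨X, Xᶜ, fun v => em (v ∈ X), disjoint_compl_right, ?_, ?_, r, hr.injOn, hr.injOn, ?_⟩
  · intro x hx x' hx' hne
    rcases lt_or_gt_of_ne (hr.ne hne) with hlt | hlt
    · exact (clique hx hlt).symm
    · exact clique hx' hlt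
  · intro y hy y' hy' hadj
    rcases lt_or_gt_of_ne (hr.ne hadj.ne) with hlt | hlt
    · exact stable hy' hlt hadj.symm
    · exact stable hy hlt hadj
  · intro x _ x' hx' y hy y' hy' hxx' hyy' hadj
    have hyx' : y ≠ x' := fun e => hy (e ▸ hx')
    have hx'y' : x' ≠ y' := fun e => hy' (e ▸ hx')
    exact dom hyy' hx'y' (dom hxx' hyx' hadj.symm).symm

theorem IsSplitHalfGraph.isTDominating_zero {V : Type*} [Finite V] {G : SimpleGraph V}
    (h : IsSplitHalfGraph G) : IsTDominating G 0 := by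
  obtain ⟨X, Y, hXY, -, hX, hY, f, -, -, hf⟩ := h
  have mem_X {w y : V} (hy : y ∈ Y) (hwy : G.Adj w y) : w ∈ X :=
    (hXY w).resolve_right fun hw => hY w hw y hy hwy
  have dom_X {u v : V} (hu : u ∈ X) (hv : v ∈ X) (hle : f v ≤ f u) : Dominates G 0 u v := by
    refine (dominates_zero_iff G u v).2 fun w hwu hwv => ?_
    rcases hXY w with hw | hw
    · exact hX w hw u hu hwu
    · exact (hf v hv u hu w hw w hw hle le_rfl hwv.symm).symm
  have dom_Y {u v : V} (hu : u ∈ Y) (hv : v ∈ Y) (hle : f v ≤ f u) : Dominates G 0 u v :=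
    (dominates_zero_iff G u v).2 fun w _ hwv =>
      hf w (mem_X hv hwv) w (mem_X hv hwv) v hv u hu le_rfl hle hwv
  have dom_XY {u v : V} (hu : u ∈ X) (hv : v ∈ Y) : Dominates G 0 u v :=
    (dominates_zero_iff G u v).2 fun w hwu hwv => hX w (mem_X hv hwv) u hu hwu
  intro u v _
  rcases hXY u with hu | hu <;> rcases hXY v with hv | hv
  · exact (le_total (f v) (f u)).imp (dom_X hu hv) (dom_X hv hu)
  · exact Or.inl (dom_XY hu hv)
  · exact Or.inr (dom_XY hv hu)
  · exact (le_total (f v) (f u)).imp (dom_Y hu hv) (dom_Y hv hu)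

theorem statement_2 {V : Type*} [Fintype V] (G : SimpleGraph V) :
    IsTDominating G 0 ↔ IsSplitHalfGraph G :=
  ⟨IsTDominating.isSplitHalfGraph, IsSplitHalfGraph.isTDominating_zero⟩
end

section
/- A graph is 0-dominating if and only if it is a threshold graph. -/
/-- `G` is a threshold graph: it can be built from the null graph by repeatedly adding either
an isolated vertex or a vertex adjacent to all current vertices; equivalently, the vertices
can be enumerated so that each vertex is isolated or universal among the earlier ones. -/
def IsThresholdGraph {V : Type*} [Fintype V] (G : SimpleGraph V) : Prop :=
  ∃ e : Fin (Fintype.card V) ≃ V,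
    ∀ i : Fin (Fintype.card V),
      (∀ j, j < i → ¬ G.Adj (e j) (e i)) ∨ (∀ j, j < i → G.Adj (e j) (e i))

/-- In a `0`-dominating graph every nonempty set of vertices contains a vertex that is isolated
or universal in the set. -/
theorem IsTDominating.exists_isolated_or_universal {V : Type*} [Finite V] {G : SimpleGraph V}
    (hG : IsTDominating G 0) {S : Finset V} (hS : S.Nonempty) :
    ∃ a ∈ S, (∀ b ∈ S, ¬ G.Adj b a) ∨ (∀ b ∈ S, b ≠ a → G.Adj b a) := by
  classical
  obtain ⟨u, huS, hmax⟩ := S.exists_max_image (fun a => (S.filter (G.Adj a)).card) hS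
  by_cases hu : ∀ b ∈ S, b ≠ u → G.Adj b u
  · exact ⟨u, huS, Or.inr hu⟩
  push Not at hu
  obtain ⟨x, hxS, hxu, hx⟩ := hu
  refine ⟨x, hxS, Or.inl fun y hyS hyx => ?_⟩
  have huy : u ≠ y := by
    rintro rfl
    exact hx hyx.symm
  have hdom : ∀ w, w ≠ y → G.Adj w u → G.Adj w y := by
    rcases hG u y huy with h | h
    · exact absurd ((dominates_zero_iff G u y).1 h x hxu hyx.symm) hx
    · exact (dominates_zero_iff G y u).1 h
  refine (hmax y hyS).not_gt ?_
  by_cases hadj : G.Adj u y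
  · have hlt : (insert u (S.filter (G.Adj u))).card < (insert y (S.filter (G.Adj y))).card := by
      refine Finset.card_lt_card (Finset.ssubset_iff_of_subset ?_ |>.2 ⟨x, ?_, ?_⟩)
      · intro w hw
        simp only [Finset.mem_insert, Finset.mem_filter] at hw ⊢
        rcases hw with rfl | ⟨hwS, hw⟩
        · exact Or.inr ⟨huS, hadj.symm⟩
        · by_cases hwy : w = y
          · exact Or.inl hwy
          · exact Or.inr ⟨hwS, (hdom w hwy hw.symm).symm⟩
      · simp [hxS, hyx]
      · simp [hxu, G.adj_comm u x, hx]
    simpa using hlt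
  · refine Finset.card_lt_card (Finset.ssubset_iff_of_subset ?_ |>.2 ⟨x, ?_, ?_⟩)
    · intro w hw
      simp only [Finset.mem_filter] at hw ⊢
      refine ⟨hw.1, (hdom w ?_ hw.2.symm).symm⟩
      rintro rfl
      exact hadj hw.2
    · simp [hxS, hyx]
    · simp [G.adj_comm u x, hx]

/-- Every set of vertices of a `0`-dominating graph can be enumerated so that each vertex is
isolated or universal among the earlier ones. -/
theorem IsTDominating.exists_enumeration {V : Type*} [Finite V] {G : SimpleGraph V}
    (hG : IsTDominating G 0) (n : ℕ) (S : Finset V) (hS : S.card = n) :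
    ∃ f : Fin n → V, Function.Injective f ∧ (∀ i, f i ∈ S) ∧
      ∀ i, (∀ j, j < i → ¬ G.Adj (f j) (f i)) ∨ (∀ j, j < i → G.Adj (f j) (f i)) := by
  classical
  induction n generalizing S with
  | zero => exact ⟨Fin.elim0, fun i => i.elim0, fun i => i.elim0, fun i => i.elim0⟩
  | succ n ih =>
    obtain ⟨a, haS, ha⟩ := hG.exists_isolated_or_universal (S := S)
      (Finset.card_pos.1 (by omega))
    obtain ⟨f, hinj, hmem, hf⟩ := ih (S.erase a) (by rw [Finset.card_erase_of_mem haS]; omega)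
    have hfS : ∀ i, f i ∈ S := fun i => Finset.mem_of_mem_erase (hmem i)
    have hfa : ∀ i, f i ≠ a := fun i => Finset.ne_of_mem_erase (hmem i)
    refine ⟨Fin.snoc f a, ?_, ?_, ?_⟩
    · rw [Fin.snoc_injective_iff]
      exact ⟨hinj, fun ⟨i, hi⟩ => hfa i hi⟩
    · intro i
      cases i using Fin.lastCases with
      | last => simpa using haS
      | cast i => simpa using hfS i
    · intro i
      cases i using Fin.lastCases with
      | last =>
        refine ha.imp (fun h j hj => ?_) (fun h j hj => ?_) <;>
          cases j using Fin.lastCases with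
          | last => exact absurd hj (lt_irrefl _)
          | cast j => simpa [hfa] using h _ (hfS j)
      | cast i =>
        refine (hf i).imp (fun h j hj => ?_) (fun h j hj => ?_) <;>
          cases j using Fin.lastCases with
          | last => exact absurd hj (Fin.castSucc_lt_last i).not_gt
          | cast j => simpa using h j (by simpa using hj)

theorem IsThresholdGraph.isTDominating_zero {V : Type*} [Fintype V] {G : SimpleGraph V}
    (hG : IsThresholdGraph G) : IsTDominating G 0 := by
  obtain ⟨e, he⟩ := hG
  intro u v huv
  rw [dominates_zero_iff, dominates_zero_iff]
  by_contra! h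
  obtain ⟨⟨w, hwu, hwv, hnwu⟩, x, hxv, hxu, hnxv⟩ := h
  have key : ∀ a b c, G.Adj b a → ¬ G.Adj c a → e.symm b < e.symm a → ¬ e.symm c < e.symm a := by
    intro a b c hb hc hba hca
    rcases he (e.symm a) with h | h
    · exact h _ hba (by simpa using hb)
    · exact hc (by simpa using h _ hca)
  have hne : ∀ {a b : V}, a ≠ b → e.symm a ≠ e.symm b := fun h => e.symm.injective.ne h
  have hwx : w ≠ x := by
    rintro rfl
    exact hnxv hwv
  have h1 := key w v u hwv.symm (fun h => hnwu h.symm)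
  have h2 := key v w x hwv hnxv
  have h3 := key u x w hxu hnwu
  have h4 := key x u v hxu.symm (fun h => hnxv h.symm)
  have n1 := hne huv
  have n2 := hne hwu
  have n3 := hne hwv.ne
  have n4 := hne hxv
  have n5 := hne hxu.ne
  have n6 := hne hwx
  omega

theorem statement_3 {V : Type*} [Fintype V] (G : SimpleGraph V) :
    IsTDominating G 0 ↔ IsThresholdGraph G := by
  refine ⟨fun hG => ?_, fun hG => hG.isTDominating_zero⟩
  obtain ⟨f, hinj, -, hf⟩ := hG.exists_enumeration _ Finset.univ Finset.card_univ
  exact ⟨Equiv.ofBijective f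
    ((Fintype.bijective_iff_injective_and_card f).2 ⟨hinj, Fintype.card_fin _⟩), hf⟩
end

section
/- Every 0-dominating graph is a split graph. -/
/-- `G` is a split graph: its vertex set can be partitioned into a clique and a stable set. -/
def IsSplitGraph {V : Type*} (G : SimpleGraph V) : Prop :=
  ∃ X Y : Set V, (∀ v, v ∈ X ∨ v ∈ Y) ∧ Disjoint X Y ∧
    (∀ x ∈ X, ∀ x' ∈ X, x ≠ x' → G.Adj x x') ∧
    (∀ y ∈ Y, ∀ y' ∈ Y, ¬ G.Adj y y')

/-- A `0`-dominating finite graph has no alternating 4-cycle: two edges `ab`, `cd` and two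
non-edges `ac`, `bd`. -/
theorem IsTDominating.not_alternating {V : Type*} [Finite V] {G : SimpleGraph V}
    (hG : IsTDominating G 0) {a b c d : V} (hab : G.Adj a b) (hcd : G.Adj c d)
    (hac : ¬ G.Adj a c) (hbd : ¬ G.Adj b d) (had : a ≠ d) (hac' : a ≠ c)
    (hbd' : b ≠ d) : False := by
  have adj_of_dominates {u v w : V} (h : Dominates G 0 u v) (hwu : w ≠ u) (hwv : G.Adj w v) :
      G.Adj w u := by
    by_contra hn
    have h0 := (Set.ncard_eq_zero (Set.toFinite _)).mp (Nat.le_zero.mp h)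
    exact Set.eq_empty_iff_forall_notMem.mp h0 w ⟨hwu, hwv.ne, hwv, hn⟩
  rcases hG a d had with h | h
  · exact hac (adj_of_dominates h hac'.symm hcd).symm
  · exact hbd (adj_of_dominates h hbd' hab.symm)

/-- A vertex outside a maximum clique has a non-neighbour in it. -/
theorem SimpleGraph.IsNClique.exists_not_adj {V : Type*} [Finite V] {G : SimpleGraph V}
    {X : Finset V} (hX : G.IsNClique G.cliqueNum X) {y : V} (hy : y ∉ X) :
    ∃ x ∈ X, ¬ G.Adj y x := by
  classical
  have := Fintype.ofFinite V
  by_contra! h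
  have := ((hX.insert h).isClique).card_le_cliqueNum
  rw [Finset.card_insert_of_notMem hy, hX.card_eq] at this
  omega

theorem statement_4 {V : Type*} [Fintype V] (G : SimpleGraph V)
    (hG : IsTDominating G 0) : IsSplitGraph G := by
  classical
  obtain ⟨X, hX⟩ := G.exists_isNClique_cliqueNum
  refine ⟨X, (X : Set V)ᶜ, fun v => em _, disjoint_compl_right,
    fun x hx x' hx' hne => hX.isClique hx hx' hne, fun y hy y' hy' hadj => ?_⟩
  replace hy : y ∉ X := by simpa using hy
  replace hy' : y' ∉ X := by simpa using hy'
  obtain ⟨x, hx, hyx⟩ := hX.exists_not_adj hy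
  obtain ⟨z, hz, hyz⟩ := hX.exists_not_adj hy'
  have unique_nonadj {a b : V} (ha : a ∈ X) (hb : b ∈ X) (hya : ¬ G.Adj y a)
      (hyb : ¬ G.Adj y' b) : a = b := by
    by_contra hab
    exact hG.not_alternating (hX.isClique ha hb hab) hadj (fun h => hya h.symm)
      (fun h => hyb h.symm) (ne_of_mem_of_not_mem ha hy') (ne_of_mem_of_not_mem ha hy)
      (ne_of_mem_of_not_mem hb hy')
  obtain rfl := unique_nonadj hx hz hyx hyz
  have adj_left : ∀ b ∈ X.erase x, G.Adj y b := fun b hb => by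
    by_contra h
    exact Finset.ne_of_mem_erase hb (unique_nonadj (Finset.mem_of_mem_erase hb) hz h hyz)
  have adj_right : ∀ b ∈ X.erase x, G.Adj y' b := fun b hb => by
    by_contra h
    exact Finset.ne_of_mem_erase hb (unique_nonadj hx (Finset.mem_of_mem_erase hb) hyx h).symm
  have hclique : G.IsNClique (X.erase x).card (X.erase x) :=
    ⟨hX.isClique.subset (by simp), rfl⟩
  have hswap := (hclique.insert adj_right).insert (a := y) fun b hb => by
    rcases Finset.mem_insert.mp hb with rfl | hb
    · exact hadj
    · exact adj_left b hb
  have hle := hswap.isClique.card_le_cliqueNum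
  rw [hswap.card_eq, Finset.card_erase_of_mem hx, ← hX.card_eq] at hle
  have := Finset.card_pos.mpr ⟨x, hx⟩
  omega
end

section
/- If G is a 0-dominating graph, d ≥ 0 is an integer, and H is a graph on the same vertex set as G such that the local difference between G and H is at most d, then H is 2d-dominating. -/
/-- Passing to a graph at local difference at most `d` costs at most `2 * d` in domination. -/
theorem Dominates.of_localDiffLE {V : Type*} [Finite V] {G H : SimpleGraph V} {t d : ℕ} {u v : V}
    (h : Dominates G t u v) (hd : LocalDiffLE G H d) : Dominates H (t + 2 * d) u v := by
  unfold Dominates at h ⊢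
  have hsub : {w : V | w ≠ u ∧ w ≠ v ∧ H.Adj w v ∧ ¬ H.Adj w u} ⊆
      {w : V | w ≠ u ∧ w ≠ v ∧ G.Adj w v ∧ ¬ G.Adj w u} ∪
        ((H.neighborSet v \ G.neighborSet v) ∪ (G.neighborSet u \ H.neighborSet u)) := by
    rintro w ⟨hwu, hwv, hv, hu⟩
    simp only [Set.mem_union, Set.mem_ofPred_eq, Set.mem_sdiff, SimpleGraph.mem_neighborSet,
      SimpleGraph.adj_comm _ v w, SimpleGraph.adj_comm _ u w]
    tauto
  have hcard := Set.ncard_le_ncard hsub (Set.toFinite _)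
  have hunion := Set.ncard_union_le {w : V | w ≠ u ∧ w ≠ v ∧ G.Adj w v ∧ ¬ G.Adj w u}
    ((H.neighborSet v \ G.neighborSet v) ∪ (G.neighborSet u \ H.neighborSet u))
  have hdiff := Set.ncard_union_le (H.neighborSet v \ G.neighborSet v)
    (G.neighborSet u \ H.neighborSet u)
  have hdu := hd u
  have hdv := hd v
  omega

theorem statement_7 {V : Type*} [Fintype V] (G H : SimpleGraph V) (d : ℕ)
    (hG : IsTDominating G 0) (hd : LocalDiffLE G H d) :
    IsTDominating H (2 * d) := by
  intro u v huv
  rw [← Nat.zero_add (2 * d)]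
  exact (hG u v huv).imp (·.of_localDiffLE hd) (·.of_localDiffLE hd)
end

section
/- For all integers t ≥ 0 and every t-restricted 0/1 matrix A indexed by [m]×[n], there is an inclusive 0/1 matrix B indexed by [m]×[n] such that the local difference between A and B is at most 644·t⁴. -/
/-- A 0/1 matrix is `t`-restricted if for all `i < i'` at most `t` columns `j` have
`a_{ij} = 1` and `a_{i'j} = 0`, and for all `j < j'` at most `t` rows `i` have
`a_{ij} = 1` and `a_{ij'} = 0`. -/
def TRestricted {m n : ℕ} (t : ℕ) (A : Fin m → Fin n → Bool) : Prop :=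
  (∀ i i' : Fin m, i < i' →
    {j : Fin n | A i j = true ∧ A i' j = false}.ncard ≤ t) ∧
  (∀ j j' : Fin n, j < j' →
    {i : Fin m | A i j = true ∧ A i j' = false}.ncard ≤ t)

/-- A 0/1 matrix is inclusive if for every pair of rows, the support of one is a subset of
the support of the other. -/
def InclusiveMat {m n : ℕ} (A : Fin m → Fin n → Bool) : Prop :=
  ∀ i i' : Fin m,
    {j : Fin n | A i j = true} ⊆ {j : Fin n | A i' j = true} ∨
    {j : Fin n | A i' j = true} ⊆ {j : Fin n | A i j = true}

/-- The local difference between two 0/1 matrices is at most `d`: in every row and in every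
column, they differ in at most `d` entries. -/
def MatLocalDiffLE {m n : ℕ} (A B : Fin m → Fin n → Bool) (d : ℕ) : Prop :=
  (∀ i : Fin m, {j : Fin n | A i j ≠ B i j}.ncard ≤ d) ∧
  (∀ j : Fin n, {i : Fin m | A i j ≠ B i j}.ncard ≤ d)

/-- Some row weakly above `i` has more than `2 * t` ones weakly to the left of column `j`. -/
def ManyOnesLeft {m n : ℕ} (t : ℕ) (A : Fin m → Fin n → Bool) (i : Fin m) (j : Fin n) : Prop :=
  ∃ i₀ ≤ i, 2 * t < {x : Fin n | x ≤ j ∧ A i₀ x = true}.ncard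

/-- Some row weakly below `i` has more than `2 * t` zeros weakly to the right of column `j`. -/
def ManyZerosRight {m n : ℕ} (t : ℕ) (A : Fin m → Fin n → Bool) (i : Fin m) (j : Fin n) : Prop :=
  ∃ i₀ ≥ i, 2 * t < {x : Fin n | j ≤ x ∧ A i₀ x = false}.ncard

/-- The entries `(i, j)` with many ones to the left such that column `j` has no zero, weakly below
`i`, at an entry with many zeros to the right. -/
def RowFilled {m n : ℕ} (t : ℕ) (A : Fin m → Fin n → Bool) (i : Fin m) (j : Fin n) : Prop :=
  ManyOnesLeft t A i j ∧ ∀ i' ≥ i, ManyZerosRight t A i' j → A i' j = true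

open Classical in
/-- The inclusive matrix approximating `A`; its definition commutes with transposition. -/
noncomputable def inclusiveApprox {m n : ℕ} (t : ℕ) (A : Fin m → Fin n → Bool)
    (i : Fin m) (j : Fin n) : Bool :=
  decide (RowFilled t A i j ∨ RowFilled t (fun j i => A i j) j i)

section

variable {m n t : ℕ} {A : Fin m → Fin n → Bool}

theorem TRestricted.transpose (hA : TRestricted t A) : TRestricted t (fun j i => A i j) :=
  ⟨hA.2, hA.1⟩

theorem inclusiveApprox_eq_true {i : Fin m} {j : Fin n} :
    inclusiveApprox t A i j = true ↔
      RowFilled t A i j ∨ RowFilled t (fun j i => A i j) j i := by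
  simp [inclusiveApprox]

theorem inclusiveApprox_transpose (i : Fin m) (j : Fin n) :
    inclusiveApprox t (fun j i => A i j) j i = inclusiveApprox t A i j := by
  rw [Bool.eq_iff_iff, inclusiveApprox_eq_true, inclusiveApprox_eq_true, or_comm]

theorem ManyOnesLeft.mono {i i' : Fin m} {j j' : Fin n} (h : ManyOnesLeft t A i j)
    (hi : i ≤ i') (hj : j ≤ j') : ManyOnesLeft t A i' j' := by
  obtain ⟨i₀, hi₀, hc⟩ := h
  exact ⟨i₀, hi₀.trans hi,
    hc.trans_le (Set.ncard_le_ncard (fun x hx => ⟨hx.1.trans hj, hx.2⟩) (Set.toFinite _))⟩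

theorem ManyZerosRight.anti {i i' : Fin m} {j j' : Fin n} (h : ManyZerosRight t A i' j')
    (hi : i ≤ i') (hj : j ≤ j') : ManyZerosRight t A i j := by
  obtain ⟨i₀, hi₀, hc⟩ := h
  exact ⟨i₀, hi.trans hi₀,
    hc.trans_le (Set.ncard_le_ncard (fun x hx => ⟨hj.trans hx.1, hx.2⟩) (Set.toFinite _))⟩

theorem RowFilled.mono {i i' : Fin m} {j : Fin n} (h : RowFilled t A i j) (hi : i ≤ i') :
    RowFilled t A i' j :=
  ⟨h.1.mono hi le_rfl, fun k hk => h.2 k (hi.trans hk)⟩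

theorem rowFilled_of_not_manyZerosRight {i : Fin m} {j : Fin n} (hL : ManyOnesLeft t A i j)
    (hR : ¬ ManyZerosRight t A i j) : RowFilled t A i j :=
  ⟨hL, fun _ hi' h => absurd (h.anti hi' le_rfl) hR⟩

/-- Many ones to the left and many zeros below exclude each other, by double counting
the entries of the block they span. -/
theorem TRestricted.not_manyZerosBelow (hA : TRestricted t A) {i : Fin m} {j : Fin n}
    (hL : ManyOnesLeft t A i j) : ¬ ManyZerosRight t (fun j i => A i j) j i := by
  classical
  rintro ⟨j₀, hj₀, hY⟩
  obtain ⟨i₀, hi₀, hX⟩ := hL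
  rw [Set.ncard_eq_toFinset_card'] at hX hY
  set X := {x : Fin n | x ≤ j ∧ A i₀ x = true}.toFinset with hXdef
  set Y := {y : Fin m | i ≤ y ∧ A y j₀ = false}.toFinset with hYdef
  have hzero : ∀ y ∈ Y, (X.filter fun x => A y x = false).card ≤ t := by
    intro y hy
    have hy' : i ≤ y ∧ A y j₀ = false := by simpa [hYdef] using hy
    rcases (hi₀.trans hy'.1).eq_or_lt with rfl | hlt
    · rw [Finset.card_eq_zero.2]
      · exact Nat.zero_le _
      · rw [Finset.filter_eq_empty_iff]
        intro x hx
        simp only [hXdef, Set.mem_toFinset, Set.mem_ofPred_eq] at hx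
        simp [hx.2]
    · refine le_trans ?_ (hA.1 i₀ y hlt)
      rw [← Set.ncard_coe_finset]
      refine Set.ncard_le_ncard (fun x hx => ?_) (Set.toFinite _)
      simp only [hXdef, Finset.coe_filter, Set.mem_toFinset, Set.mem_ofPred_eq] at hx
      exact ⟨hx.1.2, hx.2⟩
  have hone : ∀ x ∈ X, (Y.filter fun y => A y x = true).card ≤ t := by
    intro x hx
    have hx' : x ≤ j ∧ A i₀ x = true := by simpa [hXdef] using hx
    rcases (hx'.1.trans hj₀).eq_or_lt with rfl | hlt
    · rw [Finset.card_eq_zero.2]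
      · exact Nat.zero_le _
      · rw [Finset.filter_eq_empty_iff]
        intro y hy
        simp only [hYdef, Set.mem_toFinset, Set.mem_ofPred_eq] at hy
        simp [hy.2]
    · refine le_trans ?_ (hA.2 x j₀ hlt)
      rw [← Set.ncard_coe_finset]
      refine Set.ncard_le_ncard (fun y hy => ?_) (Set.toFinite _)
      simp only [hYdef, Finset.coe_filter, Set.mem_toFinset, Set.mem_ofPred_eq] at hy
      exact ⟨hy.2, hy.1.2⟩
  have hswap : ∑ y ∈ Y, (X.filter fun x => A y x = true).card
      = ∑ x ∈ X, (Y.filter fun y => A y x = true).card :=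
    Finset.sum_card_bipartiteAbove_eq_sum_card_bipartiteBelow (fun y x => A y x = true)
  have htotal : ∑ y ∈ Y, ((X.filter fun x => A y x = true).card
      + (X.filter fun x => A y x = false).card) = Y.card * X.card := by
    rw [Finset.sum_const_nat]
    intro y _
    simpa using Finset.card_filter_add_card_filter_not (s := X) (fun x => A y x = true)
  rw [Finset.sum_add_distrib, hswap] at htotal
  have h₁ := Finset.sum_le_card_nsmul X _ t hone
  have h₂ := Finset.sum_le_card_nsmul Y _ t hzero
  simp only [smul_eq_mul] at h₁ h₂
  nlinarith

theorem TRestricted.not_manyZerosRight (hA : TRestricted t A) {i : Fin m} {j : Fin n}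
    (hU : ManyOnesLeft t (fun j i => A i j) j i) : ¬ ManyZerosRight t A i j :=
  hA.transpose.not_manyZerosBelow hU

theorem ncard_zero_not_manyZerosRight_le (i : Fin m) :
    {j | ¬ ManyZerosRight t A i j ∧ A i j = false}.ncard ≤ 2 * t := by
  rcases Set.eq_empty_or_nonempty {j | ¬ ManyZerosRight t A i j ∧ A i j = false} with h | h
  · simp [h]
  · obtain ⟨j₀, hj₀, hmin⟩ := Set.exists_min_image _ id (Set.toFinite _) h
    by_contra! hc
    exact hj₀.1 ⟨i, le_rfl, hc.trans_le
      (Set.ncard_le_ncard (fun x hx => ⟨hmin x hx, hx.2⟩) (Set.toFinite _))⟩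

theorem ncard_one_not_manyOnesLeft_le (i : Fin m) :
    {j | ¬ ManyOnesLeft t A i j ∧ A i j = true}.ncard ≤ 2 * t := by
  rcases Set.eq_empty_or_nonempty {j | ¬ ManyOnesLeft t A i j ∧ A i j = true} with h | h
  · simp [h]
  · obtain ⟨j₀, hj₀, hmax⟩ := Set.exists_max_image _ id (Set.toFinite _) h
    by_contra! hc
    exact hj₀.1 ⟨i, le_rfl, hc.trans_le
      (Set.ncard_le_ncard (fun x hx => ⟨hmax x hx, hx.2⟩) (Set.toFinite _))⟩

theorem ncard_zero_union_one_le (i : Fin m) :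
    ({j | ¬ ManyZerosRight t A i j ∧ A i j = false} ∪
      {j | ¬ ManyOnesLeft t A i j ∧ A i j = true}).ncard ≤ 4 * t := by
  have h₁ := Set.ncard_union_le {j | ¬ ManyZerosRight t A i j ∧ A i j = false}
    {j | ¬ ManyOnesLeft t A i j ∧ A i j = true}
  have h₂ := ncard_zero_not_manyZerosRight_le (t := t) (A := A) i
  have h₃ := ncard_one_not_manyOnesLeft_le (t := t) (A := A) i
  omega

/-- Column `j` has few entries with both many ones to the left and many zeros to the right. -/
theorem TRestricted.ncard_manyOnesLeft_manyZerosRight_le (hA : TRestricted t A) (j : Fin n) :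
    {i | ManyOnesLeft t A i j ∧ ManyZerosRight t A i j}.ncard ≤ 4 * t := by
  refine le_trans (Set.ncard_le_ncard ?_ (Set.toFinite _))
    (ncard_zero_union_one_le (t := t) (A := fun j i => A i j) j)
  rintro i ⟨hL, hR⟩
  cases h : A i j
  · exact Or.inl ⟨hA.not_manyZerosBelow hL, h⟩
  · exact Or.inr ⟨fun hU => hA.not_manyZerosRight hU hR, h⟩

theorem TRestricted.ncard_deleted_le (hA : TRestricted t A) (i : Fin m) :
    {j | ManyOnesLeft t A i j ∧ A i j = true ∧
      ∃ i' > i, ManyZerosRight t A i' j ∧ A i' j = false}.ncard ≤ 4 * t * t := by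
  classical
  set S := {j | ManyOnesLeft t A i j ∧ A i j = true ∧
      ∃ i' > i, ManyZerosRight t A i' j ∧ A i' j = false}
  rcases Set.eq_empty_or_nonempty S with h | h
  · simp [h]
  obtain ⟨j₀, hj₀, hmin⟩ := Set.exists_min_image _ id (Set.toFinite _) h
  set T := {i' | i < i' ∧ ManyOnesLeft t A i' j₀ ∧ ManyZerosRight t A i' j₀}.toFinset with hT
  have hTcard : T.card ≤ 4 * t := by
    rw [hT, ← Set.ncard_eq_toFinset_card']
    exact le_trans (Set.ncard_le_ncard (fun _ hx => hx.2) (Set.toFinite _))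
      (hA.ncard_manyOnesLeft_manyZerosRight_le j₀)
  have hsub : S ⊆ ⋃ i' ∈ T, {j | A i j = true ∧ A i' j = false} := by
    rintro j hj
    obtain ⟨_, hone, i', hi', hR, hzero⟩ := id hj
    simp only [Set.mem_iUnion]
    refine ⟨i', ?_, hone, hzero⟩
    simp only [hT, Set.mem_toFinset, Set.mem_ofPred_eq]
    exact ⟨hi', hj₀.1.mono hi'.le le_rfl, hR.anti le_rfl (hmin j hj)⟩
  calc S.ncard ≤ _ := Set.ncard_le_ncard hsub (Set.toFinite _)
    _ ≤ ∑ i' ∈ T, {j | A i j = true ∧ A i' j = false}.ncard := Finset.set_ncard_biUnion_le _ _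
    _ ≤ T.card • t := Finset.sum_le_card_nsmul _ _ _ fun i' hi' => hA.1 i i' (by
        simp only [hT, Set.mem_toFinset, Set.mem_ofPred_eq] at hi'
        exact hi'.1)
    _ ≤ 4 * t * t := by
        rw [smul_eq_mul]
        gcongr

theorem TRestricted.ncard_row_ne_inclusiveApprox_le (hA : TRestricted t A) (i : Fin m) :
    {j | A i j ≠ inclusiveApprox t A i j}.ncard ≤ 644 * t ^ 4 := by
  have hsub : {j | A i j ≠ inclusiveApprox t A i j} ⊆
      ({j | ¬ ManyZerosRight t A i j ∧ A i j = false} ∪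
        {j | ¬ ManyOnesLeft t A i j ∧ A i j = true}) ∪
      {j | ManyOnesLeft t A i j ∧ A i j = true ∧
        ∃ i' > i, ManyZerosRight t A i' j ∧ A i' j = false} := by
    intro j hj
    have hj' : ¬ (A i j = true ↔
        RowFilled t A i j ∨ RowFilled t (fun j i => A i j) j i) := by
      rw [← inclusiveApprox_eq_true, ← Bool.eq_iff_iff]
      exact hj
    cases h : A i j
    · refine Or.inl (Or.inl ⟨fun hR => hj' ?_, h⟩)
      simp only [h, Bool.false_eq_true, false_iff, not_or]
      exact ⟨fun hf => by simpa [h] using hf.2 i le_rfl hR,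
        fun hf => hA.not_manyZerosRight hf.1 hR⟩
    · by_cases hL : ManyOnesLeft t A i j
      · refine Or.inr ⟨hL, h, ?_⟩
        by_contra! hno
        refine hj' (iff_of_true h (Or.inl ⟨hL, fun i' hi' hR => ?_⟩))
        rcases (show i ≤ i' from hi').eq_or_lt with rfl | hlt
        · exact h
        · simpa using hno i' hlt hR
      · exact Or.inl (Or.inr ⟨hL, h⟩)
  have h₁ := Set.ncard_le_ncard hsub (Set.toFinite _)
  have h₂ := h₁.trans (Set.ncard_union_le _ _)
  have h₃ := ncard_zero_union_one_le (t := t) (A := A) i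
  have h₄ := hA.ncard_deleted_le i
  have h₅ : t ≤ t ^ 4 := Nat.le_self_pow (by norm_num) t
  have h₆ : t * t ≤ t ^ 4 := by
    rw [← pow_two, show t ^ 4 = (t ^ 2) ^ 2 by ring]
    exact Nat.le_self_pow (by norm_num) _
  nlinarith

/-- `inclusiveApprox t A` contains no `2 × 2` permutation matrix. -/
theorem TRestricted.inclusiveApprox_not_crossing (hA : TRestricted t A) {i i' : Fin m}
    {j j' : Fin n} (hi : i ≤ i')
    (h₁ : inclusiveApprox t A i j = true) (h₂ : ¬ inclusiveApprox t A i' j = true)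
    (h₃ : inclusiveApprox t A i' j' = true) (h₄ : ¬ inclusiveApprox t A i j' = true) : False := by
  rw [inclusiveApprox_eq_true] at h₁ h₂ h₃ h₄
  push Not at h₂ h₄
  have hcol : RowFilled t (fun j i => A i j) j i :=
    h₁.resolve_left fun h => h₂.1 (h.mono hi)
  have hj : j' ≤ j := by
    by_contra! hlt
    exact h₄.2 (hcol.mono hlt.le)
  have hrow : RowFilled t A i' j' := h₃.resolve_right fun h => h₂.2 (h.mono hj)
  exact h₂.1 (rowFilled_of_not_manyZerosRight (hrow.1.mono le_rfl hj)
    (hA.not_manyZerosRight (hcol.1.mono le_rfl hi)))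

theorem TRestricted.inclusiveMat_inclusiveApprox (hA : TRestricted t A) :
    InclusiveMat (inclusiveApprox t A) := by
  intro i i'
  by_contra! h
  obtain ⟨j, h₁, h₂⟩ := Set.not_subset.1 h.1
  obtain ⟨j', h₃, h₄⟩ := Set.not_subset.1 h.2
  rcases le_total i i' with hi | hi
  · exact hA.inclusiveApprox_not_crossing hi h₁ h₂ h₃ h₄
  · exact hA.inclusiveApprox_not_crossing hi h₃ h₄ h₁ h₂

end

theorem statement_9 {m n : ℕ} (t : ℕ) (A : Fin m → Fin n → Bool)
    (hA : TRestricted t A) :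
    ∃ B : Fin m → Fin n → Bool, InclusiveMat B ∧ MatLocalDiffLE A B (644 * t ^ 4) := by
  refine ⟨inclusiveApprox t A, hA.inclusiveMat_inclusiveApprox,
    hA.ncard_row_ne_inclusiveApprox_le, fun j => ?_⟩
  simpa only [inclusiveApprox_transpose] using hA.transpose.ncard_row_ne_inclusiveApprox_le j
end

section
/- For all integers t, w ≥ 0 with 2w ≥ t+1, and every t-restricted 0/1 matrix A indexed by [m]×[n] with breadth at most w, there is an inclusive 0/1 matrix B indexed by [m]×[n] such that the local difference between A and B is at most 2(t+w)·w³. -/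
/-- A subset `F` of `[m] × [n]` is up-closed if whenever `(i,j) ∈ F`, `i ≤ i'` and `j ≤ j'`,
we have `(i',j') ∈ F`. -/
def UpClosed {m n : ℕ} (F : Set (Fin m × Fin n)) : Prop :=
  ∀ i i' : Fin m, ∀ j j' : Fin n, i ≤ i' → j ≤ j' → (i, j) ∈ F → (i', j') ∈ F

/-- A subset `F` of `[m] × [n]` is down-closed if its complement is up-closed. -/
def DownClosed {m n : ℕ} (F : Set (Fin m × Fin n)) : Prop :=
  UpClosed Fᶜ

/-- The maximal down-closed subset of `E`. -/
def maxDownClosedIn {m n : ℕ} (E : Set (Fin m × Fin n)) : Set (Fin m × Fin n) :=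
  ⋃₀ {F : Set (Fin m × Fin n) | DownClosed F ∧ F ⊆ E}

/-- The maximal up-closed subset of `E`. -/
def maxUpClosedIn {m n : ℕ} (E : Set (Fin m × Fin n)) : Set (Fin m × Fin n) :=
  ⋃₀ {F : Set (Fin m × Fin n) | UpClosed F ∧ F ⊆ E}

/-- The breadth of `A` is at most `w`: every diagonal of `A` (the pairs `(i,j)` with
`j = i + c` avoiding the maximal down-closed subset `X` of the zero set and the maximal
up-closed subset `Y` of the support) has cardinality at most `w`. -/
def BreadthLE {m n : ℕ} (A : Fin m → Fin n → Bool) (w : ℕ) : Prop :=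
  ∀ c : ℤ,
    {p : Fin m × Fin n | ((p.2 : ℕ) : ℤ) = ((p.1 : ℕ) : ℤ) + c ∧
      p ∉ maxDownClosedIn {q : Fin m × Fin n | A q.1 q.2 = false} ∪
          maxUpClosedIn {q : Fin m × Fin n | A q.1 q.2 = true}}.ncard ≤ w

/-! ### Matrices as a pair of relations on `ℤ × ℤ`

The ones and the zeros of a matrix are encoded by two relations `T F : ℤ → ℤ → Prop`. -/

/-- Some one of the matrix lies weakly above and to the left of `(i, j)`. -/
def Reach (T : ℤ → ℤ → Prop) (i j : ℤ) : Prop :=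
  ∃ i' j', i' ≤ i ∧ j' ≤ j ∧ T i' j'

/-- Some zero of the matrix lies weakly below and to the right of `(i, j)`. -/
def Coreach (F : ℤ → ℤ → Prop) (i j : ℤ) : Prop :=
  ∃ i' j', i ≤ i' ∧ j ≤ j' ∧ F i' j'

/-- Some column contains a vertical stretch of undetermined cells centred at row `i`
and extending by `K` in both directions. -/
def DeepRow (T F : ℤ → ℤ → Prop) (K : ℕ) (i : ℤ) : Prop :=
  ∃ c, Reach T (i - K) c ∧ Coreach F (i + K) c

/-- Some row contains a horizontal stretch of undetermined cells centred at column `j`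
and extending by `K` in both directions. -/
def DeepCol (T F : ℤ → ℤ → Prop) (K : ℕ) (j : ℤ) : Prop :=
  ∃ r, Reach T r (j - K) ∧ Coreach F r (j + K)

/-- The band of undetermined cells has diagonals of length at most `w`. -/
def BandLE (T F : ℤ → ℤ → Prop) (w : ℕ) : Prop :=
  ∀ i j i' j', Reach T i j → Coreach F i' j' → i' < i + w ∨ j' < j + w

/-- The up-closed pattern used at the cells whose row and column are both not deep. -/
def Staircase (T F : ℤ → ℤ → Prop) (K : ℕ) (i j : ℤ) : Prop :=
  ¬ Coreach F i j ∨
    ∃ p q, p ≤ i ∧ q ≤ j ∧ DeepRow T F K p ∧ DeepCol T F K q ∧ Reach T p j ∧ Reach T i q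

/-- The inclusive approximation: deep columns are made monotone downwards, deep rows are made
monotone to the right, and the remaining cells follow the staircase. -/
def Approx (T F : ℤ → ℤ → Prop) (K : ℕ) (i j : ℤ) : Prop :=
  (DeepCol T F K j ∧ ∃ i' ≤ i, T i' j) ∨ (DeepRow T F K i ∧ ∃ j' ≤ j, T i j') ∨
    (¬ DeepCol T F K j ∧ ¬ DeepRow T F K i ∧ Staircase T F K i j)

section Relations

variable {T F : ℤ → ℤ → Prop} {K w : ℕ} {i i' j j' : ℤ}

theorem Reach.mono (h : Reach T i j) (hi : i ≤ i') (hj : j ≤ j') : Reach T i' j' := by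
  obtain ⟨a, b, ha, hb, h⟩ := h
  exact ⟨a, b, ha.trans hi, hb.trans hj, h⟩

theorem Coreach.mono (h : Coreach F i j) (hi : i' ≤ i) (hj : j' ≤ j) : Coreach F i' j' := by
  obtain ⟨a, b, ha, hb, h⟩ := h
  exact ⟨a, b, hi.trans ha, hj.trans hb, h⟩

theorem Reach.of_one (h : T i j) : Reach T i j := ⟨i, j, le_rfl, le_rfl, h⟩

theorem Coreach.of_zero (h : F i j) : Coreach F i j := ⟨i, j, le_rfl, le_rfl, h⟩

theorem reach_swap : Reach (Function.swap T) j i ↔ Reach T i j := by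
  constructor <;> rintro ⟨a, b, ha, hb, h⟩ <;> exact ⟨b, a, hb, ha, h⟩

theorem coreach_swap : Coreach (Function.swap F) j i ↔ Coreach F i j := by
  constructor <;> rintro ⟨a, b, ha, hb, h⟩ <;> exact ⟨b, a, hb, ha, h⟩

theorem deepRow_swap : DeepRow (Function.swap T) (Function.swap F) K j ↔ DeepCol T F K j := by
  simp only [DeepRow, DeepCol, reach_swap, coreach_swap]

theorem deepCol_swap : DeepCol (Function.swap T) (Function.swap F) K i ↔ DeepRow T F K i := by
  simp only [DeepRow, DeepCol, reach_swap, coreach_swap]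

theorem BandLE.swap (h : BandLE T F w) : BandLE (Function.swap T) (Function.swap F) w :=
  fun i j i' j' hP hQ => (h j i j' i' (reach_swap.1 hP) (coreach_swap.1 hQ)).symm

theorem staircase_swap :
    Staircase (Function.swap T) (Function.swap F) K j i ↔ Staircase T F K i j := by
  simp only [Staircase, reach_swap, coreach_swap, deepRow_swap, deepCol_swap]
  refine or_congr_right ?_
  constructor <;> rintro ⟨p, q, hp, hq, h₁, h₂, h₃, h₄⟩ <;>
    exact ⟨q, p, hq, hp, h₂, h₁, h₄, h₃⟩

theorem approx_swap :
    Approx (Function.swap T) (Function.swap F) K j i ↔ Approx T F K i j := by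
  simp only [Approx, staircase_swap, deepRow_swap, deepCol_swap, Function.swap]
  rw [or_left_comm, and_left_comm (a := ¬ DeepRow T F K i)]

theorem Staircase.mono (h : Staircase T F K i j) (hi : i ≤ i') (hj : j ≤ j') :
    Staircase T F K i' j' := by
  rcases h with h | ⟨p, q, hp, hq, h₁, h₂, h₃, h₄⟩
  · exact Or.inl fun h' => h (h'.mono hi hj)
  · exact Or.inr ⟨p, q, hp.trans hi, hq.trans hj, h₁, h₂, h₃.mono le_rfl hj, h₄.mono hi le_rfl⟩

/-- The undetermined cells of a deep row lie close to any witnessing column. -/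
theorem BandLE.near_of_deepRow (hb : BandLE T F w) (hK : w ≤ K) {c : ℤ}
    (hP : Reach T (i - K) c) (hQ : Coreach F (i + K) c) (hp : Reach T i j)
    (hq : Coreach F i j) : c < j + w ∧ j < c + w := by
  have h₁ := hb _ _ _ _ hp hQ
  have h₂ := hb _ _ _ _ hP hq
  omega

/-- The undetermined cells of a deep column lie close to any witnessing row. -/
theorem BandLE.near_of_deepCol (hb : BandLE T F w) (hK : w ≤ K) {r : ℤ}
    (hP : Reach T r (j - K)) (hQ : Coreach F r (j + K)) (hp : Reach T i j)
    (hq : Coreach F i j) : r < i + w ∧ i < r + w :=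
  hb.swap.near_of_deepRow hK (reach_swap.2 hP) (coreach_swap.2 hQ) (reach_swap.2 hp)
    (coreach_swap.2 hq)

/-- A deep row and a deep column do not cross at an undetermined cell. -/
theorem BandLE.not_deep_deep (hb : BandLE T F w) (hK : 3 * w ≤ K + 2) (hw : 1 ≤ w)
    (hR : DeepRow T F K i) (hC : DeepCol T F K j) (hp : Reach T i j) (hq : Coreach F i j) :
    False := by
  obtain ⟨c, hPc, hQc⟩ := hR
  obtain ⟨r, hPr, hQr⟩ := hC
  have h₁ := hb.near_of_deepRow (by omega) hPc hQc hp hq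
  have h₂ := hb.near_of_deepCol (by omega) hPr hQr hp hq
  have h₃ := hb _ _ _ _ hPc hQr
  omega

/-- A deep row below and a deep column to the right of an undetermined cell, both meeting the band
there, exclude a deep row above and a deep column to the left. -/
theorem BandLE.not_cross (hb : BandLE T F w) (hK : 3 * w ≤ K + 2) (hw : 1 ≤ w)
    {p q : ℤ} (hi : i < i') (hj : j < j') (hpi : p ≤ i) (hqj : q ≤ j)
    (hRi' : DeepRow T F K i') (hCj' : DeepCol T F K j')
    (hRp : DeepRow T F K p) (hCq : DeepCol T F K q)
    (hPp : Reach T p j) (hPq : Reach T i q)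
    (hQ₁ : Coreach F i' j) (hQ₂ : Coreach F i j') : False := by
  obtain ⟨c, hPc, hQc⟩ := hRi'
  obtain ⟨r, hPr, hQr⟩ := hCj'
  obtain ⟨c₀, hPc₀, hQc₀⟩ := hRp
  obtain ⟨r₀, hPr₀, hQr₀⟩ := hCq
  have hPij : Reach T i j := hPp.mono hpi le_rfl
  have hQij : Coreach F i j := hQ₁.mono hi.le le_rfl
  have h₁ := hb.near_of_deepRow (by omega) hPc hQc (hPij.mono hi.le le_rfl) hQ₁
  have h₂ := hb.near_of_deepCol (by omega) hPr hQr (hPij.mono le_rfl hj.le) hQ₂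
  have h₃ := hb.near_of_deepRow (by omega) hPc₀ hQc₀ hPp (hQij.mono hpi le_rfl)
  have h₄ := hb.near_of_deepCol (by omega) hPr₀ hQr₀ hPq (hQij.mono le_rfl hqj)
  have h₅ := hb _ _ _ _ hPc hQr
  have h₆ := hb _ _ _ _ hPr₀ hQc₀
  have h₇ := hb _ _ _ _ hPp hQ₂
  have h₈ := hb _ _ _ _ hPr hQc
  omega

theorem reach_of_approx (hTF : T i j ∨ F i j) (h : Approx T F K i j) : Reach T i j := by
  rcases h with ⟨_, a, ha, h⟩ | ⟨_, a, ha, h⟩ | ⟨_, _, h | ⟨p, q, hp, hq, _, _, h, _⟩⟩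
  · exact ⟨a, j, ha, le_rfl, h⟩
  · exact ⟨i, a, le_rfl, ha, h⟩
  · exact Reach.of_one (hTF.resolve_right fun h' => h (Coreach.of_zero h'))
  · exact h.mono hp le_rfl

theorem coreach_of_not_approx (hTF : T i j ∨ F i j) (h : ¬ Approx T F K i j) :
    Coreach F i j := by
  by_contra hQ
  have hT : T i j := hTF.resolve_right fun h' => hQ (Coreach.of_zero h')
  by_cases hC : DeepCol T F K j
  · exact h (Or.inl ⟨hC, i, le_rfl, hT⟩)
  by_cases hR : DeepRow T F K i
  · exact h (Or.inr (Or.inl ⟨hR, j, le_rfl, hT⟩))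
  · exact h (Or.inr (Or.inr ⟨hC, hR, Or.inl hQ⟩))

theorem approx_iff_of_deepCol (hb : BandLE T F w) (hK : 3 * w ≤ K + 2) (hw : 1 ≤ w)
    (hTF : T i j ∨ F i j) (hC : DeepCol T F K j) :
    Approx T F K i j ↔ ∃ a ≤ i, T a j := by
  refine ⟨fun h => ?_, fun h => Or.inl ⟨hC, h⟩⟩
  rcases h with h | ⟨hR, b, hbj, h⟩ | h
  · exact h.2
  · refine ⟨i, le_rfl, hTF.resolve_right fun h' => ?_⟩
    exact hb.not_deep_deep hK hw hR hC ⟨i, b, le_rfl, hbj, h⟩ (Coreach.of_zero h')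
  · exact absurd hC h.1

theorem approx_iff_of_deepRow (hb : BandLE T F w) (hK : 3 * w ≤ K + 2) (hw : 1 ≤ w)
    (hTF : T i j ∨ F i j) (hR : DeepRow T F K i) :
    Approx T F K i j ↔ ∃ b ≤ j, T i b := by
  rw [← approx_swap, approx_iff_of_deepCol hb.swap hK hw hTF (deepCol_swap.2 hR)]

theorem approx_iff_of_not_deep (hC : ¬ DeepCol T F K j) (hR : ¬ DeepRow T F K i) :
    Approx T F K i j ↔ Staircase T F K i j := by
  simp [Approx, hC, hR]

/-- If the approximation decreases down a column, the column is not deep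
but one of the two rows is. -/
theorem deep_of_column_decrease (hb : BandLE T F w) (hK : 3 * w ≤ K + 2) (hw : 1 ≤ w)
    (hi : i ≤ i') (h₁ : T i j ∨ F i j) (h₂ : T i' j ∨ F i' j)
    (hB : Approx T F K i j) (hB' : ¬ Approx T F K i' j) :
    ¬ DeepCol T F K j ∧ (DeepRow T F K i ∨ DeepRow T F K i') := by
  have hC : ¬ DeepCol T F K j := by
    intro hC
    rw [approx_iff_of_deepCol hb hK hw h₁ hC] at hB
    rw [approx_iff_of_deepCol hb hK hw h₂ hC] at hB'
    obtain ⟨a, ha, h⟩ := hB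
    exact hB' ⟨a, ha.trans hi, h⟩
  refine ⟨hC, ?_⟩
  by_contra! hR
  rw [approx_iff_of_not_deep hC hR.1] at hB
  rw [approx_iff_of_not_deep hC hR.2] at hB'
  exact hB' (hB.mono hi le_rfl)

theorem deep_of_row_decrease (hb : BandLE T F w) (hK : 3 * w ≤ K + 2) (hw : 1 ≤ w)
    (hj : j ≤ j') (h₁ : T i j ∨ F i j) (h₂ : T i j' ∨ F i j')
    (hB : Approx T F K i j) (hB' : ¬ Approx T F K i j') :
    ¬ DeepRow T F K i ∧ (DeepCol T F K j ∨ DeepCol T F K j') := by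
  simpa only [deepRow_swap, deepCol_swap] using
    deep_of_column_decrease hb.swap hK hw hj h₁ h₂ (approx_swap.2 hB) (mt approx_swap.1 hB')

/-- The approximation contains no `2 × 2` permutation submatrix. -/
theorem approx_no_permutation (hb : BandLE T F w) (hK : 3 * w ≤ K + 2) (hw : 1 ≤ w)
    (hi : i < i') (h₁ : T i j ∨ F i j) (h₂ : T i j' ∨ F i j')
    (h₃ : T i' j ∨ F i' j) (h₄ : T i' j' ∨ F i' j')
    (hB₁ : Approx T F K i j) (hB₂ : ¬ Approx T F K i j')
    (hB₃ : ¬ Approx T F K i' j) (hB₄ : Approx T F K i' j') : False := by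
  have hcol := deep_of_column_decrease hb hK hw hi.le h₁ h₃ hB₁ hB₃
  rcases lt_trichotomy j j' with hj | rfl | hj
  · have hrow := deep_of_row_decrease hb hK hw hj.le h₁ h₂ hB₁ hB₂
    have hR := hcol.2.resolve_left hrow.1
    have hC := hrow.2.resolve_left hcol.1
    have hQ₃ := coreach_of_not_approx h₃ hB₃
    rw [approx_iff_of_not_deep hcol.1 hrow.1] at hB₁
    rcases hB₁ with h | ⟨p, q, hp, hq, hRp, hCq, hPp, hPq⟩
    · exact h (hQ₃.mono hi.le le_rfl)
    · exact hb.not_cross hK hw hi hj hp hq hR hC hRp hCq hPp hPq hQ₃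
        (coreach_of_not_approx h₂ hB₂)
  · exact hB₂ hB₁
  · have hrow := deep_of_row_decrease hb hK hw hj.le h₄ h₃ hB₄ hB₃
    have hR := hcol.2.resolve_right hrow.1
    have hC := hrow.2.resolve_right hcol.1
    rw [approx_iff_of_not_deep hcol.1 hrow.1] at hB₃
    exact hB₃ (Or.inr ⟨i, j', hi.le, hj.le, hR, hC, reach_of_approx h₁ hB₁,
      reach_of_approx h₄ hB₄⟩)

end Relations

theorem ncard_le_of_spread {n : ℕ} (S : Set (Fin n)) (d : ℕ)
    (h : ∀ x ∈ S, ∀ y ∈ S, (y : ℤ) < (x : ℤ) + d) : S.ncard ≤ d := by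
  rcases S.eq_empty_or_nonempty with rfl | hne
  · simp
  obtain ⟨a, ha, hmin⟩ := S.exists_min_image id S.toFinite hne
  have hsub : (fun x : Fin n => (x : ℕ)) '' S ⊆ (Finset.Ico (a : ℕ) (a + d) : Finset ℕ) := by
    rintro _ ⟨x, hx, rfl⟩
    have h₁ := h a ha x hx
    have h₂ : a ≤ x := hmin x hx
    have h₃ : (a : ℕ) ≤ x := h₂
    simp only [Finset.coe_Ico, Set.mem_Ico]
    omega
  calc S.ncard = ((fun x : Fin n => (x : ℕ)) '' S).ncard :=
        (Set.ncard_image_of_injective S Fin.val_injective).symm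
    _ ≤ ((Finset.Ico (a : ℕ) (a + d) : Finset ℕ) : Set ℕ).ncard :=
        Set.ncard_le_ncard hsub (Finset.finite_toSet _)
    _ = d := by rw [Set.ncard_coe_finset]; simp

/-- In every row, the approximation differs from the matrix in few entries. -/
theorem approx_row_difference {T F : ℤ → ℤ → Prop} {K w t n : ℕ} {i : ℤ}
    (hb : BandLE T F w) (hK : 3 * w ≤ K + 2) (hw : 1 ≤ w)
    (hTF : ∀ j : Fin n, T i j ∨ F i j) (hdisj : ∀ j : Fin n, ¬ (T i j ∧ F i j))
    (ht : ∀ i' < i, {j : Fin n | T i' j ∧ F i j}.ncard ≤ t) :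
    {j : Fin n | (T i j ∧ ¬ Approx T F K i j) ∨ (F i j ∧ Approx T F K i j)}.ncard
      ≤ 2 * K + w + (w - 1) * t := by
  have hband : ∀ j : Fin n, (T i j ∧ ¬ Approx T F K i j) ∨ (F i j ∧ Approx T F K i j) →
      Reach T i j ∧ Coreach F i j := by
    rintro j (⟨h, hB⟩ | ⟨h, hB⟩)
    · exact ⟨Reach.of_one h, coreach_of_not_approx (hTF j) hB⟩
    · exact ⟨reach_of_approx (hTF j) hB, Coreach.of_zero h⟩
  by_cases hR : DeepRow T F K i
  · obtain ⟨c, hPc, hQc⟩ := hR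
    refine (ncard_le_of_spread _ (2 * w - 1) fun x hx y hy => ?_).trans (by omega)
    have h₁ := hb.near_of_deepRow (by omega) hPc hQc (hband x hx).1 (hband x hx).2
    have h₂ := hb.near_of_deepRow (by omega) hPc hQc (hband y hy).1 (hband y hy).2
    omega
  let S₁ : Set (Fin n) := {j | Reach T i j ∧ ¬ Reach T i (j - K)}
  let S₂ : Set (Fin n) := {j | Coreach F i j ∧ ¬ Coreach F i (j + K)}
  let S₃ : Set (Fin n) := {j | Reach T (i - w) j ∧ Coreach F i j}
  let D : ℤ → Set (Fin n) := fun i' => {j | T i' j ∧ F i j}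
  have hS₁ : S₁.ncard ≤ K := ncard_le_of_spread _ _ fun x hx y hy => by
    by_contra! hlt
    exact hy.2 (hx.1.mono le_rfl (by omega))
  have hS₂ : S₂.ncard ≤ K := ncard_le_of_spread _ _ fun x hx y hy => by
    by_contra! hlt
    exact hx.2 (hy.1.mono le_rfl (by omega))
  have hS₃ : S₃.ncard ≤ w := ncard_le_of_spread _ _ fun x hx y hy => by
    have := hb _ _ _ _ hx.1 hy.2
    omega
  have hD : (⋃ i' ∈ Finset.Ioo (i - w) i, D i').ncard ≤ (w - 1) * t := by
    refine (Finset.set_ncard_biUnion_le _ _).trans ?_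
    refine (Finset.sum_le_card_nsmul _ _ t fun i' hi' => ht i' (Finset.mem_Ioo.1 hi').2).trans ?_
    rw [Int.card_Ioo, smul_eq_mul]
    exact Nat.mul_le_mul_right _ (by omega)
  have hsub : {j : Fin n | (T i j ∧ ¬ Approx T F K i j) ∨ (F i j ∧ Approx T F K i j)} ⊆
      S₁ ∪ S₂ ∪ S₃ ∪ ⋃ i' ∈ Finset.Ioo (i - w) i, D i' := by
    intro j hj
    obtain ⟨hP, hQ⟩ := hband j hj
    by_cases hC : DeepCol T F K j
    · rw [Set.mem_ofPred_eq, approx_iff_of_deepCol hb hK hw (hTF j) hC] at hj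
      rcases hj with ⟨h, hB⟩ | ⟨h, a, ha, hB⟩
      · exact absurd ⟨i, le_rfl, h⟩ hB
      rcases le_or_gt a (i - w) with haw | haw
      · exact Or.inl (Or.inr ⟨⟨a, j, haw, le_rfl, hB⟩, hQ⟩)
      rcases ha.lt_or_eq with hlt | rfl
      · exact Or.inr (Set.mem_biUnion (Finset.mem_coe.2 (Finset.mem_Ioo.2 ⟨haw, hlt⟩)) ⟨hB, h⟩)
      · exact absurd ⟨hB, h⟩ (hdisj j)
    · by_cases h₁ : Reach T i (j - K)
      · exact Or.inl (Or.inl (Or.inr ⟨hQ, fun h₂ => hC ⟨i, h₁, h₂⟩⟩))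
      · exact Or.inl (Or.inl (Or.inl ⟨hP, h₁⟩))
  calc _ ≤ (S₁ ∪ S₂ ∪ S₃ ∪ ⋃ i' ∈ Finset.Ioo (i - w) i, D i').ncard :=
        Set.ncard_le_ncard hsub (Set.toFinite _)
    _ ≤ S₁.ncard + S₂.ncard + S₃.ncard + (⋃ i' ∈ Finset.Ioo (i - w) i, D i').ncard :=
        (Set.ncard_union_le _ _).trans (Nat.add_le_add_right ((Set.ncard_union_le _ _).trans
          (Nat.add_le_add_right (Set.ncard_union_le _ _) _)) _)
    _ ≤ 2 * K + w + (w - 1) * t := by omega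

/-- The cells of a matrix with value `b`, as a relation on the integers. -/
def CellsWith {m n : ℕ} (A : Fin m → Fin n → Bool) (b : Bool) (i j : ℤ) : Prop :=
  ∃ (x : Fin m) (y : Fin n), (x : ℤ) = i ∧ (y : ℤ) = j ∧ A x y = b

theorem cellsWith_coe {m n : ℕ} {A : Fin m → Fin n → Bool} {b : Bool} {x : Fin m} {y : Fin n} :
    CellsWith A b x y ↔ A x y = b := by
  constructor
  · rintro ⟨x', y', hx, hy, h⟩
    obtain rfl : x' = x := Fin.ext (by omega)
    obtain rfl : y' = y := Fin.ext (by omega)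
    exact h
  · exact fun h => ⟨x, y, rfl, rfl, h⟩

theorem BreadthLE.bandLE {m n w : ℕ} {A : Fin m → Fin n → Bool} (h : BreadthLE A w) :
    BandLE (CellsWith A true) (CellsWith A false) w := by
  rintro i j i' j' ⟨_, _, hai, haj, a, b, rfl, rfl, hA⟩ ⟨_, _, hci, hdj, c, d, rfl, rfl, hA'⟩
  by_contra! hlt
  have hc := c.isLt
  have hd := d.isLt
  let φ : Fin (w + 1) → Fin m × Fin n := fun k =>
    (⟨i.toNat + k, by omega⟩, ⟨j.toNat + k, by omega⟩)
  have hφ : Function.Injective φ := by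
    intro k k' hk
    simp only [φ, Prod.mk.injEq, Fin.mk.injEq] at hk
    exact Fin.ext (by omega)
  have hcard : (Set.range φ).ncard = w + 1 := by
    rw [← Set.image_univ, Set.ncard_image_of_injective _ hφ, Set.ncard_univ, Nat.card_fin]
  have hle := (Set.ncard_le_ncard (s := Set.range φ) ?_ (Set.toFinite _)).trans (h (j - i))
  · omega
  rintro _ ⟨k, rfl⟩
  have hk := k.isLt
  refine ⟨by simp only [φ]; omega, ?_⟩
  rintro (⟨S, ⟨hS, hsub⟩, hmem⟩ | ⟨S, ⟨hS, hsub⟩, hmem⟩)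
  · have hab : (a, b) ∉ S := fun h' => by simpa [hA] using hsub h'
    refine hS a _ b _ ?_ ?_ hab hmem <;> rw [Fin.le_def] <;> simp only <;> omega
  · have hcd : (c, d) ∈ S := by
      refine hS _ c _ d ?_ ?_ hmem <;> rw [Fin.le_def] <;> simp only <;> omega
    simpa [hA'] using hsub hcd

/-- A matrix without `2 × 2` permutation submatrices is inclusive. -/
theorem inclusiveMat_of_no_permutation {m n : ℕ} {B : Fin m → Fin n → Bool}
    (h : ∀ i i' j j', i < i' → B i j = true → B i j' = false → B i' j = false →
      B i' j' = true → False) : InclusiveMat B := by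
  intro i i'
  by_contra! hcon
  obtain ⟨⟨j, hj, hj'⟩, ⟨k, hk, hk'⟩⟩ := hcon.imp Set.not_subset.1 Set.not_subset.1
  simp only [Set.mem_ofPred_eq, Bool.not_eq_true] at hj hj' hk hk'
  rcases lt_trichotomy i i' with hi | rfl | hi
  · exact h i i' j k hi hj hk' hj' hk
  · simp [hj] at hj'
  · exact h i' i k j hi hk hj' hk' hj

theorem inclusiveMat_of_tRestricted_zero {m n : ℕ} {A : Fin m → Fin n → Bool}
    (hA : TRestricted 0 A) : InclusiveMat A := by
  refine inclusiveMat_of_no_permutation fun i i' j _ hi h₁ _ h₂ _ => ?_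
  have h := (Set.ncard_eq_zero (Set.toFinite _)).1 (Nat.le_zero.1 (hA.1 i i' hi))
  exact Set.eq_empty_iff_forall_notMem.1 h j ⟨h₁, h₂⟩

theorem difference_bound {t w : ℕ} (ht : 1 ≤ t) (hw : 1 ≤ w) :
    2 * (3 * w - 2) + w + (w - 1) * t ≤ 2 * (t + w) * w ^ 3 := by
  obtain ⟨v, rfl⟩ := Nat.exists_eq_add_of_le hw
  obtain ⟨s, rfl⟩ := Nat.exists_eq_add_of_le ht
  have h : 3 * (1 + v) - 2 = 3 * v + 1 := by omega
  rw [h, Nat.add_sub_cancel_left]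
  ring_nf
  nlinarith [Nat.zero_le (s * v), Nat.zero_le (s * v ^ 2), Nat.zero_le (s * v ^ 3),
    Nat.zero_le (v ^ 2), Nat.zero_le (v ^ 3), Nat.zero_le (v ^ 4)]

theorem ncard_cells_le {m n t : ℕ} {A : Fin m → Fin n → Bool} (i : Fin m) {a : ℤ} (ha : a < i)
    (hA : ∀ x, x < i → {j : Fin n | A x j = true ∧ A i j = false}.ncard ≤ t) :
    {j : Fin n | CellsWith A true a j ∧ CellsWith A false i j}.ncard ≤ t := by
  by_cases ha₀ : ∃ x : Fin m, (x : ℤ) = a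
  · obtain ⟨x, rfl⟩ := ha₀
    simp only [cellsWith_coe]
    exact hA x (Fin.lt_def.2 (by omega))
  · convert Nat.zero_le t
    rw [Set.ncard_eq_zero (Set.toFinite _), Set.eq_empty_iff_forall_notMem]
    rintro _ ⟨⟨x, _, hx, _⟩, _⟩
    exact ha₀ ⟨x, hx⟩

theorem cellsWith_swap {m n : ℕ} {A : Fin m → Fin n → Bool} {b : Bool} :
    Function.swap (CellsWith A b) = CellsWith (Function.swap A) b := by
  ext i j
  constructor <;> rintro ⟨x, y, hx, hy, h⟩ <;> exact ⟨y, x, hy, hx, h⟩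

theorem statement_10 {m n : ℕ} (t w : ℕ) (hw : t + 1 ≤ 2 * w)
    (A : Fin m → Fin n → Bool) (hA : TRestricted t A) (hbr : BreadthLE A w) :
    ∃ B : Fin m → Fin n → Bool,
      InclusiveMat B ∧ MatLocalDiffLE A B (2 * (t + w) * w ^ 3) := by
  rcases Nat.eq_zero_or_pos t with rfl | ht
  · exact ⟨A, inclusiveMat_of_tRestricted_zero hA, by constructor <;> simp⟩
  have hw₁ : 1 ≤ w := by omega
  have hK : 3 * w ≤ (3 * w - 2) + 2 := by omega
  have hb := hbr.bandLE
  have hTF : ∀ (x : Fin m) (y : Fin n), CellsWith A true x y ∨ CellsWith A false x y := by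
    intro x y
    rw [cellsWith_coe, cellsWith_coe]
    cases A x y <;> simp
  have hdisj : ∀ (x : Fin m) (y : Fin n), ¬ (CellsWith A true x y ∧ CellsWith A false x y) := by
    intro x y
    rw [cellsWith_coe, cellsWith_coe]
    cases A x y <;> simp
  classical
  let B : Fin m → Fin n → Bool := fun x y =>
    decide (Approx (CellsWith A true) (CellsWith A false) (3 * w - 2) x y)
  refine ⟨B, inclusiveMat_of_no_permutation fun i i' j j' hi h₁ h₂ h₃ h₄ => ?_, fun i => ?_,
    fun j => ?_⟩
  · simp only [B, decide_eq_true_eq, decide_eq_false_iff_not] at h₁ h₂ h₃ h₄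
    have hi' : (i : ℕ) < i' := hi
    exact approx_no_permutation hb hK hw₁ (by omega) (hTF _ _) (hTF _ _) (hTF _ _) (hTF _ _)
      h₁ h₂ h₃ h₄
  · refine le_trans ?_ (difference_bound ht hw₁)
    refine le_trans (Set.ncard_le_ncard ?_ (Set.toFinite _))
      (approx_row_difference (n := n) (i := i) hb hK hw₁ (hTF i) (hdisj i)
        fun a ha => ncard_cells_le i ha fun x hx => hA.1 x i hx)
    intro j hj
    simp only [B, Set.mem_ofPred_eq, cellsWith_coe] at hj ⊢
    cases h : A i j <;> simp_all
  · refine le_trans ?_ (difference_bound ht hw₁)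
    refine le_trans (Set.ncard_le_ncard ?_ (Set.toFinite _))
      (approx_row_difference (n := m) (i := j) hb.swap hK hw₁ (fun i => hTF i j)
        (fun i => hdisj i j) fun a ha => ?_)
    · intro i hi
      simp only [B, Set.mem_ofPred_eq, approx_swap, Function.swap, cellsWith_coe] at hi ⊢
      cases h : A i j <;> simp_all
    · rw [cellsWith_swap, cellsWith_swap]
      exact ncard_cells_le j ha fun y hy => hA.2 y j hy
end

section
/- For every integer t ≥ 0 and every t-dominating split graph G, there is a split half-graph H with V(H) = V(G) such that the local difference between G and H is at most 644·t⁴. -/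
namespace SplitHalfGraph

open Finset
open scoped Classical

variable {A B : Type*} [Fintype A] [Fintype B]

/-- The number of elements satisfying `P` which are at or below `x` in the ranking `p`. -/
noncomputable def lowCount (p : A → ℕ) (P : A → Prop) (x : A) : ℕ :=
  #{z | p z ≤ p x ∧ P z}

/-- The number of elements violating `P` which are at or above `x` in the ranking `p`. -/
noncomputable def highCount (p : A → ℕ) (P : A → Prop) (x : A) : ℕ :=
  #{z | p x ≤ p z ∧ ¬ P z}

/-- Rows of `R` ranked higher by `p` contain all but `s` elements of rows ranked lower. -/
def RowDominated (p : A → ℕ) (R : A → B → Prop) (s : ℕ) : Prop :=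
  ∀ x z, p x ≤ p z → #{y | R x y ∧ ¬ R z y} ≤ s

/-- At most `d` elements satisfy `P` but not `Q`, and at most `e` satisfy `Q` but not `P`. -/
def CloseTo (P Q : A → Prop) (d e : ℕ) : Prop :=
  #{x | P x ∧ ¬ Q x} ≤ d ∧ #{x | ¬ P x ∧ Q x} ≤ e

/-- The seed pairs from which the approximating half-graph is generated. -/
def Seed (p : A → ℕ) (q : B → ℕ) (R : A → B → Prop) (s k : ℕ) (x : A) (y : B) : Prop :=
  (R x y ∧ 2 * s ≤ lowCount p (R · y) x) ∨ ∃ z, p z ≤ p x ∧ k ≤ lowCount q (R z) y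

/-- The closure of the seed pairs upwards in the second coordinate. -/
def Stair (p : A → ℕ) (q : B → ℕ) (R : A → B → Prop) (s k : ℕ) (x : A) (y : B) : Prop :=
  ∃ y', q y' ≤ q y ∧ Seed p q R s k x y'

lemma lowCount_mono {p : A → ℕ} (P : A → Prop) {x x' : A} (h : p x ≤ p x') :
    lowCount p P x ≤ lowCount p P x' := by
  apply card_le_card
  intro z
  simp only [mem_filter_univ]
  exact fun hz => ⟨hz.1.trans h, hz.2⟩

lemma highCount_anti {p : A → ℕ} (P : A → Prop) {x x' : A} (h : p x ≤ p x') :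
    highCount p P x' ≤ highCount p P x := by
  apply card_le_card
  intro z
  simp only [mem_filter_univ]
  exact fun hz => ⟨h.trans hz.1, hz.2⟩

lemma card_lowCount_le (p : A → ℕ) (P : A → Prop) (k : ℕ) :
    #{x | P x ∧ lowCount p P x ≤ k} ≤ k := by
  rcases (univ.filter fun x => P x ∧ lowCount p P x ≤ k).eq_empty_or_nonempty with h | h
  · simp [h]
  · obtain ⟨x, hx, hmax⟩ := exists_max_image _ p h
    refine le_trans (card_le_card ?_) (mem_filter.1 hx).2.2
    intro z hz
    exact mem_filter.2 ⟨mem_univ _, hmax z hz, (mem_filter.1 hz).2.1⟩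

lemma card_highCount_le (p : A → ℕ) (P : A → Prop) (k : ℕ) :
    #{x | ¬ P x ∧ highCount p P x ≤ k} ≤ k := by
  rcases (univ.filter fun x => ¬ P x ∧ highCount p P x ≤ k).eq_empty_or_nonempty with h | h
  · simp [h]
  · obtain ⟨x, hx, hmin⟩ := exists_min_image _ p h
    refine le_trans (card_le_card ?_) (mem_filter.1 hx).2.2
    intro z hz
    exact mem_filter.2 ⟨mem_univ _, hmin z hz, (mem_filter.1 hz).2.1⟩

lemma card_interval_le (q : B → ℕ) (y : B) (k : ℕ) :
    #{z | q z ≤ q y ∧ #{w | q z ≤ q w ∧ q w ≤ q y} ≤ k} ≤ k := by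
  rcases (univ.filter fun z => q z ≤ q y ∧ #{w | q z ≤ q w ∧ q w ≤ q y} ≤ k).eq_empty_or_nonempty
    with h | h
  · simp [h]
  · obtain ⟨x, hx, hmin⟩ := exists_min_image _ q h
    refine le_trans (card_le_card ?_) (mem_filter.1 hx).2.2
    intro z hz
    exact mem_filter.2 ⟨mem_univ _, hmin z hz, (mem_filter.1 hz).2.1⟩

lemma lowCount_le_add {A B : Type*} [Fintype B] {p : A → ℕ} (q : B → ℕ) {R : A → B → Prop} {s : ℕ}
    (hA : RowDominated p R s) {x x' : A} (h : p x ≤ p x') (y : B) :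
    lowCount q (R x) y ≤ lowCount q (R x') y + s := by
  refine le_trans ?_ (Nat.add_le_add_left (hA x x' h) _)
  refine le_trans (card_le_card ?_) (card_union_le _ _)
  intro z
  simp only [mem_filter_univ, mem_union]
  tauto

/-- If a row has many elements at or below `y`, then almost all rows above it contain `y`. -/
lemma highCount_le_of_le_lowCount {p : A → ℕ} {q : B → ℕ} {R : A → B → Prop} {s : ℕ}
    (hs : 1 ≤ s) (hA : RowDominated p R s) (hB : RowDominated q (fun y x => R x y) s)
    {x : A} {y : B} (h : 2 * s ≤ lowCount q (R x) y) :
    highCount p (R · y) x ≤ 2 * s := by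
  unfold lowCount at h
  unfold highCount
  set S : Finset B := {z | q z ≤ q y ∧ R x z} with hS
  set Z : Finset A := {z | p x ≤ p z ∧ ¬ R z y} with hZ
  have hcount : #S * #Z ≤ #S * s + #Z * s := by
    have h₁ : #(S ×ˢ Z) = #((S ×ˢ Z).filter fun a => R a.2 a.1) +
        #((S ×ˢ Z).filter fun a => ¬ R a.2 a.1) :=
      (card_filter_add_card_filter_not _).symm
    have h₂ : #((S ×ˢ Z).filter fun a => R a.2 a.1) ≤ #S * s := by
      rw [card_filter, sum_product]
      rw [← smul_eq_mul]
      refine sum_le_card_nsmul _ _ _ fun z hz => ?_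
      rw [← card_filter]
      refine le_trans (card_le_card ?_) (hB z y (mem_filter.1 hz).2.1)
      intro w
      simp only [hZ, mem_filter, mem_univ, true_and]
      tauto
    have h₃ : #((S ×ˢ Z).filter fun a => ¬ R a.2 a.1) ≤ #Z * s := by
      rw [card_filter, sum_product_right]
      rw [← smul_eq_mul]
      refine sum_le_card_nsmul _ _ _ fun z hz => ?_
      rw [← card_filter]
      refine le_trans (card_le_card ?_) (hA x z (mem_filter.1 hz).2.1)
      intro w
      simp only [hS, mem_filter, mem_univ, true_and]
      tauto
    rw [card_product] at h₁
    omega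
  by_contra! hlt
  obtain ⟨m, hm⟩ := Nat.exists_eq_add_of_le h
  obtain ⟨n, hn⟩ := Nat.exists_eq_add_of_lt hlt
  rw [hm, hn] at hcount
  nlinarith [Nat.zero_le (m * n), Nat.zero_le (m * s), Nat.zero_le (s * n), Nat.zero_le m]

lemma Stair.mono {p : A → ℕ} {q : B → ℕ} {R : A → B → Prop} {s k : ℕ} {x : A} {y y' : B}
    (h : q y ≤ q y') (hxy : Stair p q R s k x y) : Stair p q R s k x y' :=
  let ⟨z, hz, hC⟩ := hxy
  ⟨z, hz.trans h, hC⟩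

/-- Every column of the staircase is close to the corresponding column of `R`. -/
lemma closeTo_stair_column {p : A → ℕ} {q : B → ℕ} {R : A → B → Prop} {s k : ℕ}
    (hs : 1 ≤ s) (hk : 3 * s ≤ k)
    (hA : RowDominated p R s) (hB : RowDominated q (fun y x => R x y) s) (y : B) :
    CloseTo (R · y) (Stair p q R s k · y) (2 * s) (2 * s + 4 * s * s) := by
  constructor
  · refine le_trans (card_le_card ?_) (card_lowCount_le p (R · y) (2 * s))
    intro x
    simp only [mem_filter_univ]
    rintro ⟨hR, hH⟩
    refine ⟨hR, ?_⟩
    by_contra! hlt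
    exact hH ⟨y, le_rfl, Or.inl ⟨hR, hlt.le⟩⟩
  · set W : Finset B := {z | q z ≤ q y ∧ #{w | q z ≤ q w ∧ q w ≤ q y} ≤ 4 * s} with hW
    have hWcard : #(W.biUnion fun z => univ.filter fun x => R x z ∧ ¬ R x y) ≤ 4 * s * s := by
      refine (card_biUnion_le_card_mul _ _ s fun z hz => ?_).trans
        (Nat.mul_le_mul_right _ (card_interval_le q y (4 * s)))
      exact hB z y (mem_filter.1 hz).2.1
    refine le_trans (card_le_card ?_) ((card_union_le _ _).trans
      (Nat.add_le_add (card_highCount_le p (R · y) (2 * s)) hWcard))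
    intro x
    simp only [mem_filter_univ, mem_union, mem_biUnion, hW]
    rintro ⟨hR, z, hz, hC⟩
    by_cases hd : highCount p (R · y) x ≤ 2 * s
    · exact Or.inl ⟨hR, hd⟩
    right
    have ha : lowCount q (R x) y < 2 * s := by
      by_contra! h
      exact hd (highCount_le_of_le_lowCount hs hA hB h)
    rcases hC with ⟨hxz, hb⟩ | ⟨x', hx', hx'z⟩
    · refine ⟨z, ⟨hz, ?_⟩, hxz, hR⟩
      have hc : highCount q (R x) z ≤ 2 * s :=
        highCount_le_of_le_lowCount (R := fun y x => R x y) hs hB hA hb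
      have : #{w | q z ≤ q w ∧ q w ≤ q y} ≤ lowCount q (R x) y + highCount q (R x) z := by
        refine le_trans (card_le_card ?_) (card_union_le _ _)
        intro w
        simp only [mem_filter_univ, mem_union]
        tauto
      omega
    · have h₁ := lowCount_le_add q hA hx' z
      have h₂ := lowCount_mono (R x) hz
      omega

/-- A row of the staircase is close to a row of `R` that is close to an upper set. -/
lemma closeTo_stair_row {p : A → ℕ} {q : B → ℕ} {R : A → B → Prop} {s k d e : ℕ}
    (hs : 1 ≤ s) (hk : s + d + 1 ≤ k)
    (hA : RowDominated p R s) (hB : RowDominated q (fun y x => R x y) s) (x : A)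
    {U : B → Prop} (hU : ∀ y y', q y ≤ q y' → U y → U y') (hclose : CloseTo (R x) U d e) :
    CloseTo (R x) (Stair p q R s k x) k (2 * s + e) := by
  constructor
  · refine le_trans (card_le_card ?_) (card_lowCount_le q (R x) k)
    intro y
    simp only [mem_filter_univ]
    rintro ⟨hR, hH⟩
    refine ⟨hR, ?_⟩
    by_contra! hlt
    exact hH ⟨y, le_rfl, Or.inr ⟨x, le_rfl, hlt.le⟩⟩
  · refine le_trans (card_le_card ?_) ((card_union_le _ _).trans
      (Nat.add_le_add (card_highCount_le q (R x) (2 * s)) hclose.2))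
    intro y
    simp only [mem_filter_univ, mem_union]
    rintro ⟨hR, z, hz, ⟨hxz, hb⟩ | ⟨x', hx', hx'z⟩⟩
    · exact Or.inl ⟨hR, (highCount_anti (R x) hz).trans
        (highCount_le_of_le_lowCount (R := fun y x => R x y) hs hB hA hb)⟩
    · refine Or.inr ⟨hR, hU z y hz ?_⟩
      by_contra hUz
      have h₁ := lowCount_le_add q hA hx' z
      have h₂ : lowCount q (R x) z ≤ d := by
        refine le_trans (card_le_card ?_) hclose.1
        intro w
        simp only [mem_filter_univ]
        exact fun hw => ⟨hw.2, fun hUw => hUz (hU w z hw.1 hUw)⟩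
      omega

/-- Lexicographic refinement of a function by an injective ranking. -/
lemma exists_lex_ranking (n p : A → ℕ) (hp : Function.Injective p) :
    ∃ r : A → ℕ, Function.Injective r ∧
      ∀ x x', r x ≤ r x' → n x < n x' ∨ n x = n x' ∧ p x ≤ p x' := by
  obtain ⟨M, hM⟩ : ∃ M, ∀ x, p x < M :=
    ⟨univ.sup p + 1, fun x => Nat.lt_succ_of_le (le_sup (mem_univ x))⟩
  have key : ∀ x x', n x * M + p x ≤ n x' * M + p x' →
      n x < n x' ∨ n x = n x' ∧ p x ≤ p x' := by
    intro x x' h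
    rcases lt_trichotomy (n x) (n x') with hlt | heq | hgt
    · exact Or.inl hlt
    · exact Or.inr ⟨heq, by rw [heq] at h; omega⟩
    · have := Nat.mul_le_mul_right M (Nat.succ_le_of_lt hgt)
      have := hM x'
      rw [Nat.succ_mul] at *
      omega
  refine ⟨fun x => n x * M + p x, fun x x' h => hp ?_, key⟩
  have h₁ := key x x' h.le
  have h₂ := key x' x h.ge
  omega

lemma exists_ranking (n : A → ℕ) :
    ∃ r : A → ℕ, Function.Injective r ∧ ∀ x x', r x ≤ r x' → n x ≤ n x' := by
  obtain ⟨r, hr, h⟩ := exists_lex_ranking n (fun x => (Fintype.equivFin A x : ℕ))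
    (Fin.val_injective.comp (Fintype.equivFin A).injective)
  exact ⟨r, hr, fun x x' hx => (h x x' hx).elim le_of_lt fun h => h.1.le⟩

/-- Upper sets of a ranking are nested according to their size. -/
lemma upper_subset_of_card_le {q : B → ℕ} {P Q : B → Prop}
    (hP : ∀ y y', q y ≤ q y' → P y → P y') (hQ : ∀ y y', q y ≤ q y' → Q y → Q y')
    (h : #{y | P y} ≤ #{y | Q y}) (y : B) (hy : P y) : Q y := by
  by_contra hn
  refine h.not_gt (card_lt_card (Finset.ssubset_iff_subset_ne.2 ⟨fun z => ?_, fun heq => ?_⟩))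
  · simp only [mem_filter_univ]
    intro hz
    refine hP y z ?_ hy
    by_contra! hlt
    exact hn (hQ z y hlt.le hz)
  · have : y ∈ univ.filter Q := heq ▸ mem_filter.2 ⟨mem_univ _, hy⟩
    exact hn (mem_filter.1 this).2

/-- The rows can be ranked so that they are still dominated and every column of `R` is close to
an upper set of rows. -/
lemma exists_ranking_sorting_columns {p : A → ℕ} {q : B → ℕ} {R : A → B → Prop} {s : ℕ}
    (hs : 1 ≤ s) (hp : Function.Injective p)
    (hA : RowDominated p R s) (hB : RowDominated q (fun y x => R x y) s) :
    ∃ r : A → ℕ, Function.Injective r ∧ RowDominated r R (5 * s) ∧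
      ∀ y, ∃ U : A → Prop, (∀ x x', r x ≤ r x' → U x → U x') ∧
        CloseTo (R · y) U (2 * s) (2 * s + 4 * s * s) := by
  set T := Stair p q R s (3 * s) with hT
  obtain ⟨r, hr, hlex⟩ := exists_lex_ranking (fun x => #{y | T x y}) p hp
  have hup : ∀ x y y', q y ≤ q y' → T x y → T x y' := fun x y y' h hxy => hxy.mono h
  refine ⟨r, hr, fun x x' h => ?_, fun y => ⟨(T · y), fun x x' h => ?_,
    closeTo_stair_column hs le_rfl hA hB y⟩⟩
  · rcases le_total (p x) (p x') with hpx | hpx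
    · exact (hA x x' hpx).trans (by omega)
    rcases hlex x x' h with hlt | ⟨-, hle⟩
    swap
    · exact (hA x x' hle).trans (by omega)
    obtain ⟨y, hy', hy⟩ : ∃ y, T x' y ∧ ¬ T x y := by
      by_contra! hsub
      refine hlt.not_ge (card_le_card fun y => ?_)
      simpa only [mem_filter_univ] using hsub y
    obtain ⟨z, hz, hC⟩ := hy'
    have hnC : ¬ Seed p q R s (3 * s) x z := fun hC => hy ⟨z, hz, hC⟩
    rcases hC with ⟨hx'z, hb⟩ | ⟨w, hw, hwz⟩
    · have hc : highCount q (R x') z ≤ 2 * s :=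
        highCount_le_of_le_lowCount (R := fun y x => R x y) hs hB hA hb
      have ha : lowCount q (R x) z ≤ 3 * s := by
        by_contra! hlt
        exact hnC (Or.inr ⟨x, le_rfl, hlt.le⟩)
      have : #{y | R x y ∧ ¬ R x' y} ≤ lowCount q (R x) z + highCount q (R x') z := by
        refine le_trans (card_le_card ?_) (card_union_le _ _)
        intro w
        simp only [mem_filter_univ, mem_union]
        rcases le_total (q w) (q z) with hwz | hwz <;> tauto
      omega
    · exact absurd (Or.inr ⟨w, hw.trans hpx, hwz⟩) hnC
  · exact upper_subset_of_card_le (hup x) (hup x')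
      ((hlex x x' h).elim le_of_lt fun h => h.1.le) y

/-- Rows pairwise comparable up to `s` elements are dominated in any ranking by size. -/
lemma exists_rowDominated {R : A → B → Prop} {s : ℕ}
    (h : ∀ x x', x ≠ x' → #{y | R x y ∧ ¬ R x' y} ≤ s ∨ #{y | R x' y ∧ ¬ R x y} ≤ s) :
    ∃ p : A → ℕ, Function.Injective p ∧ RowDominated p R s := by
  obtain ⟨p, hp, hmono⟩ := exists_ranking fun x => #{y | R x y}
  refine ⟨p, hp, fun x x' hx => ?_⟩
  by_cases hne : x = x'
  · simp [hne]
  rcases h x x' hne with h | h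
  · exact h
  have hle : #(univ.filter (R x)) ≤ #(univ.filter (R x')) := hmono x x' hx
  have h₁ := card_filter_add_card_filter_not (s := univ.filter (R x)) (R x')
  have h₂ := card_filter_add_card_filter_not (s := univ.filter (R x')) (R x)
  simp only [filter_filter] at h₁ h₂
  simp only [and_comm (a := R x' _) (b := R x _)] at h₂
  simp only [and_comm (a := R x' _) (b := ¬ R x _)] at h h₂
  omega

/-- A relation whose rows and whose columns are pairwise comparable up to `t` elements is close
to a half-graph. -/
theorem exists_halfGraph_closeTo (R : A → B → Prop) (t : ℕ)
    (hA : ∀ x x', x ≠ x' → #{y | R x y ∧ ¬ R x' y} ≤ t ∨ #{y | R x' y ∧ ¬ R x y} ≤ t)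
    (hB : ∀ y y', y ≠ y' → #{x | R x y ∧ ¬ R x y'} ≤ t ∨ #{x | R x y' ∧ ¬ R x y} ≤ t) :
    ∃ (T : A → B → Prop) (p : A → ℕ) (q : B → ℕ), Function.Injective p ∧ Function.Injective q ∧
      (∀ x x' y y', p x ≤ p x' → q y ≤ q y' → T x y → T x' y') ∧
      (∀ x, #{y | R x y ∧ ¬ T x y} + #{y | ¬ R x y ∧ T x y} ≤ 644 * t ^ 4) ∧
      (∀ y, #{x | R x y ∧ ¬ T x y} + #{x | ¬ R x y ∧ T x y} ≤ 644 * t ^ 4) := by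
  obtain ⟨p, hp, hpA⟩ := exists_rowDominated hA
  obtain ⟨q, hq, hqB⟩ := exists_rowDominated (R := fun y x => R x y) hB
  rcases Nat.eq_zero_or_pos t with rfl | ht
  · refine ⟨R, p, q, hp, hq, fun x x' y y' hx hy hxy => ?_, by simp, by simp⟩
    have h₁ := hpA x x' hx
    have h₂ := hqB y y' hy
    simp only [nonpos_iff_eq_zero, card_eq_zero, filter_eq_empty_iff, mem_univ, true_imp_iff,
      not_and, not_not] at h₁ h₂
    exact h₂ (h₁ hxy)
  obtain ⟨r, hr, hrA, hcol⟩ := exists_ranking_sorting_columns ht hp hpA hqB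
  have hqB' : RowDominated q (fun y x => R x y) (5 * t) := fun y y' h =>
    (hqB y y' h).trans (by omega)
  set k := 17 * t + 1 with hk
  set T := Stair q r (fun y x => R x y) (5 * t) k with hT
  have hup : ∀ y x x', r x ≤ r x' → T y x → T y x' := fun y x x' h hxy => hxy.mono h
  obtain ⟨q', hq', hmono⟩ := exists_ranking fun y => #{x | T y x}
  have ht2 : t ≤ t ^ 2 := Nat.le_self_pow two_ne_zero t
  have ht4 : t ^ 2 ≤ t ^ 4 := Nat.pow_le_pow_right ht (by norm_num)
  refine ⟨fun x y => T y x, r, q', hr, hq', fun x x' y y' hx hy hxy => ?_, fun x => ?_,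
    fun y => ?_⟩
  · exact hup y' x x' hx (upper_subset_of_card_le (hup y) (hup y') (hmono y y' hy) x hxy)
  · have h := closeTo_stair_column (k := k) (by omega) (by omega) hqB' hrA x
    refine (Nat.add_le_add h.1 h.2).trans ?_
    nlinarith
  · obtain ⟨U, hU, hclose⟩ := hcol y
    have h := closeTo_stair_row (k := k) (by omega) (by omega) hqB' hrA y hU hclose
    refine (Nat.add_le_add h.1 h.2).trans ?_
    nlinarith

lemma card_le_ncard {V : Type*} [Finite V] {Z S : Set V} [Fintype Z] {P : Z → Prop}
    [DecidablePred P] (h : ∀ z, P z → (z : V) ∈ S) : #{z | P z} ≤ S.ncard := by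
  rw [← Set.ncard_coe_finset]
  refine Set.ncard_le_ncard_of_injOn (↑) (fun z hz => h z ?_) Subtype.val_injective.injOn
    (Set.toFinite S)
  simpa using hz

lemma ncard_le_card {V : Type*} {Z S : Set V} [Fintype Z] {P : Z → Prop}
    [DecidablePred P] (h : ∀ w ∈ S, ∃ hw : w ∈ Z, P ⟨w, hw⟩) : S.ncard ≤ #{z | P z} := by
  rw [← Set.ncard_coe_finset, ← Set.ncard_image_of_injective _ Subtype.val_injective]
  refine Set.ncard_le_ncard (fun w hw => ?_) (Set.toFinite _)
  obtain ⟨hwZ, hP⟩ := h w hw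
  exact ⟨⟨w, hwZ⟩, by simpa using hP, rfl⟩

end SplitHalfGraph

open SplitHalfGraph

theorem statement_12 {V : Type*} [Fintype V] (t : ℕ) (G : SimpleGraph V)
    (hdom : IsTDominating G t) (hsplit : IsSplitGraph G) :
    ∃ H : SimpleGraph V, IsSplitHalfGraph H ∧ LocalDiffLE G H (644 * t ^ 4) := by
  classical
  obtain ⟨X, Y, hXY, hdisj, hX, hY⟩ := hsplit
  have hnX : ∀ y ∈ Y, y ∉ X := fun y hy hx => Set.disjoint_left.1 hdisj hx hy
  have hne : ∀ x ∈ X, ∀ y ∈ Y, x ≠ y := fun x hx y hy h => hnX y hy (h ▸ hx)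
  have hXcomp : ∀ x x' : X, Dominates G t x' x →
      (Finset.univ.filter fun y : Y => G.Adj x y ∧ ¬ G.Adj x' y).card ≤ t := by
    intro x x' h
    refine le_trans (card_le_ncard ?_) h
    exact fun y hy => ⟨(hne _ x'.2 _ y.2).symm, (hne _ x.2 _ y.2).symm, hy.1.symm,
      fun hadj => hy.2 hadj.symm⟩
  have hYcomp : ∀ y y' : Y, Dominates G t y' y →
      (Finset.univ.filter fun x : X => G.Adj x y ∧ ¬ G.Adj x y').card ≤ t := by
    intro y y' h
    refine le_trans (card_le_ncard ?_) h
    exact fun x hx => ⟨hne _ x.2 _ y'.2, hne _ x.2 _ y.2, hx⟩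
  obtain ⟨T, p, q, hp, hq, hmono, hrow, hcol⟩ := exists_halfGraph_closeTo
    (fun (x : X) (y : Y) => G.Adj x y) t
    (fun x x' hne => (hdom x x' (Subtype.coe_injective.ne hne)).symm.imp
      (hXcomp x x') (hXcomp x' x))
    (fun y y' hne => (hdom y y' (Subtype.coe_injective.ne hne)).symm.imp
      (hYcomp y y') (hYcomp y' y))
  let H : SimpleGraph V := SimpleGraph.fromRel fun u v =>
    (u ∈ X ∧ v ∈ X) ∨ ∃ (hu : u ∈ X) (hv : v ∈ Y), T ⟨u, hu⟩ ⟨v, hv⟩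
  have hHX : ∀ x ∈ X, ∀ x' ∈ X, x ≠ x' → H.Adj x x' := fun x hx x' hx' h =>
    ⟨h, Or.inl (Or.inl ⟨hx, hx'⟩)⟩
  have hHY : ∀ y ∈ Y, ∀ y' ∈ Y, ¬ H.Adj y y' := by
    rintro y hy y' hy' ⟨-, (h | ⟨h, -⟩) | (h | ⟨h, -⟩)⟩
    exacts [hnX y hy h.1, hnX y hy h, hnX y' hy' h.1, hnX y' hy' h]
  have hHT : ∀ (x : X) (y : Y), H.Adj x y ↔ T x y := by
    refine fun x y => ⟨?_, fun h => ⟨hne _ x.2 _ y.2, Or.inl (Or.inr ⟨x.2, y.2, h⟩)⟩⟩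
    rintro ⟨-, (h | ⟨_, _, h⟩) | (h | ⟨h, -⟩)⟩
    exacts [(hnX y y.2 h.2).elim, h, (hnX y y.2 h.1).elim, (hnX y y.2 h).elim]
  refine ⟨H, ⟨X, Y, hXY, hdisj, hHX, hHY,
    fun v => if h : v ∈ X then p ⟨v, h⟩ else if h : v ∈ Y then q ⟨v, h⟩ else 0, ?_, ?_, ?_⟩, ?_⟩
  · intro x hx x' hx' h
    simp only [hx, hx', dif_pos] at h
    exact congrArg Subtype.val (hp h)
  · intro y hy y' hy' h
    simp only [hnX y hy, hnX y' hy', hy, hy', dif_pos, dif_neg, not_false_eq_true] at h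
    exact congrArg Subtype.val (hq h)
  · intro x hx x' hx' y hy y' hy' h₁ h₂ h
    simp only [hx, hx', dif_pos] at h₁
    simp only [hnX y hy, hnX y' hy', hy, hy', dif_pos, dif_neg, not_false_eq_true] at h₂
    exact (hHT ⟨x', hx'⟩ ⟨y', hy'⟩).2 (hmono _ _ _ _ h₁ h₂ ((hHT ⟨x, hx⟩ ⟨y, hy⟩).1 h))
  · intro v
    rcases hXY v with hv | hv
    · refine le_trans (Nat.add_le_add (ncard_le_card ?_) (ncard_le_card ?_)) (hrow ⟨v, hv⟩)
      · rintro w ⟨hG, hH⟩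
        have hw : w ∈ Y := (hXY w).resolve_left fun hw => hH (hHX v hv w hw hG.ne)
        exact ⟨hw, hG, fun h => hH ((hHT ⟨v, hv⟩ ⟨w, hw⟩).2 h)⟩
      · rintro w ⟨hH, hG⟩
        have hw : w ∈ Y := (hXY w).resolve_left fun hw => hG (hX v hv w hw (H.ne_of_adj hH))
        exact ⟨hw, hG, (hHT ⟨v, hv⟩ ⟨w, hw⟩).1 hH⟩
    · refine le_trans (Nat.add_le_add (ncard_le_card ?_) (ncard_le_card ?_)) (hcol ⟨v, hv⟩)
      · rintro w ⟨hG, hH⟩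
        have hw : w ∈ X := (hXY w).resolve_right fun hw => hY v hv w hw hG
        exact ⟨hw, hG.symm, fun h => hH ((hHT ⟨w, hw⟩ ⟨v, hv⟩).2 h).symm⟩
      · rintro w ⟨hH, hG⟩
        have hw : w ∈ X := (hXY w).resolve_right fun hw => hHY v hv w hw hH
        exact ⟨hw, fun h => hG h.symm, (hHT ⟨w, hw⟩ ⟨v, hv⟩).1 hH.symm⟩
end

section
/- Let G be a t-dominating split graph whose vertex set is partitioned into a clique M = {u₁,…,u_m} and a stable set N = {v₁,…,v_n}, where u₁,…,u_m are ordered so that deg(u_i) ≤ deg(u_j) whenever i < j, and v₁,…,v_n are ordered so that deg(v_i) ≤ deg(v_j) whenever i < j (degrees taken in G). Then the 0/1 matrix A = (a_{ij}) indexed by [m]×[n], defined by a_{ij} = 1 if u_i and v_j are adjacent in G and a_{ij} = 0 otherwise, is t-restricted. -/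
/-- In a finite `t`-dominating graph, a vertex of larger or equal degree `t`-dominates a vertex
of smaller or equal degree. -/
theorem IsTDominating.dominates_of_ncard_le {V : Type*} [Finite V] {G : SimpleGraph V} {t : ℕ}
    (h : IsTDominating G t) {a b : V} (hab : a ≠ b)
    (hdeg : (G.neighborSet a).ncard ≤ (G.neighborSet b).ncard) : Dominates G t b a := by
  have key : ∀ x y : V, {w : V | w ≠ x ∧ w ≠ y ∧ G.Adj w y ∧ ¬ G.Adj w x} =
      (G.neighborSet y \ {x}) \ (G.neighborSet x \ {y}) := by
    intro x y
    ext w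
    have hy : w = y → ¬ G.Adj y w := by rintro rfl; exact G.irrefl
    simp only [Set.mem_ofPred_eq, Set.mem_sdiff, SimpleGraph.mem_neighborSet,
      Set.mem_singleton_iff, G.adj_comm w]
    tauto
  have hcard : (G.neighborSet a \ {b}).ncard ≤ (G.neighborSet b \ {a}).ncard := by
    by_cases hadj : G.Adj a b
    · rw [Set.ncard_sdiff_singleton_of_mem (by simpa using hadj),
        Set.ncard_sdiff_singleton_of_mem (by simpa using hadj.symm)]
      omega
    · rw [Set.sdiff_singleton_eq_self (by simpa using hadj),
        Set.sdiff_singleton_eq_self (by simpa [G.adj_comm b] using hadj)]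
      exact hdeg
  refine (h b a hab.symm).elim id fun hdom => ?_
  unfold Dominates at hdom ⊢
  rw [key] at hdom ⊢
  exact ((Set.ncard_le_ncard_iff_ncard_sdiff_le_ncard_sdiff).1 hcard).trans hdom

theorem statement_13 {V : Type*} [Fintype V] (t m n : ℕ) (G : SimpleGraph V)
    (u : Fin m → V) (v : Fin n → V)
    (hu : Function.Injective u) (hv : Function.Injective v)
    (huv : ∀ i j, u i ≠ v j)
    (hcover : ∀ x : V, (∃ i, u i = x) ∨ (∃ j, v j = x))
    (hclique : ∀ i j : Fin m, i ≠ j → G.Adj (u i) (u j))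
    (hstable : ∀ i j : Fin n, ¬ G.Adj (v i) (v j))
    (hudeg : ∀ i j : Fin m, i < j →
      (G.neighborSet (u i)).ncard ≤ (G.neighborSet (u j)).ncard)
    (hvdeg : ∀ i j : Fin n, i < j →
      (G.neighborSet (v i)).ncard ≤ (G.neighborSet (v j)).ncard)
    (hdom : IsTDominating G t)
    (A : Fin m → Fin n → Bool)
    (hA : ∀ i j, A i j = true ↔ G.Adj (u i) (v j)) :
    TRestricted t A := by
  have hA_false : ∀ i j, A i j = false ↔ ¬ G.Adj (u i) (v j) := fun i j => by
    rw [← hA, Bool.not_eq_true]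
  constructor
  · intro i i' hlt
    refine le_trans ?_ (hdom.dominates_of_ncard_le (hu.ne hlt.ne) (hudeg i i' hlt))
    rw [← Set.ncard_image_of_injective _ hv]
    refine Set.ncard_le_ncard ?_
    rintro _ ⟨j, ⟨h, h'⟩, rfl⟩
    exact ⟨(huv i' j).symm, (huv i j).symm, ((hA i j).1 h).symm,
      fun hadj => (hA_false i' j).1 h' hadj.symm⟩
  · intro j j' hlt
    refine le_trans ?_ (hdom.dominates_of_ncard_le (hv.ne hlt.ne) (hvdeg j j' hlt))
    rw [← Set.ncard_image_of_injective _ hu]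
    refine Set.ncard_le_ncard ?_
    rintro _ ⟨i, ⟨h, h'⟩, rfl⟩
    exact ⟨huv i j', huv i j, (hA i j).1 h, (hA_false i j').1 h'⟩
end

section
/- For every integer t ≥ 0 and every t-dominating graph G, there is a t-dominating split graph H with V(H) = V(G) such that the local difference between G and H is at most 2t. -/
namespace SimpleGraph

variable {V : Type*}

/-- The split graph obtained from `G` by making `X` a clique and its complement stable. -/
def splitAt (G : SimpleGraph V) (X : Set V) : SimpleGraph V where
  Adj u v := u ≠ v ∧ ((u ∈ X ∧ v ∈ X) ∨ (G.Adj u v ∧ (u ∈ X ∨ v ∈ X)))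
  symm := ⟨fun _ _ h => ⟨h.1.symm, h.2.imp And.symm fun h => ⟨h.1.symm, h.2.symm⟩⟩⟩
  loopless := ⟨fun _ h => h.1 rfl⟩

theorem splitAt_adj {G : SimpleGraph V} {X : Set V} {u v : V} :
    (G.splitAt X).Adj u v ↔ u ≠ v ∧ ((u ∈ X ∧ v ∈ X) ∨ (G.Adj u v ∧ (u ∈ X ∨ v ∈ X))) :=
  Iff.rfl

theorem isSplitGraph_splitAt (G : SimpleGraph V) (X : Set V) : IsSplitGraph (G.splitAt X) := by
  refine ⟨X, Xᶜ, fun v => em _, disjoint_compl_right, fun x hx y hy h => ⟨h, .inl ⟨hx, hy⟩⟩, ?_⟩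
  rintro x hx y hy ⟨-, h | h⟩
  · exact hx h.1
  · exact h.2.elim hx hy

theorem dominates_splitAt_of_mem_of_notMem (G : SimpleGraph V) {X : Set V} {u v : V} (t : ℕ)
    (hu : u ∈ X) (hv : v ∉ X) : Dominates (G.splitAt X) t u v := by
  have h : {w : V | w ≠ u ∧ w ≠ v ∧ (G.splitAt X).Adj w v ∧ ¬ (G.splitAt X).Adj w u} = ∅ := by
    ext w
    simp only [splitAt_adj, Set.mem_ofPred_eq, Set.mem_empty_iff_false, iff_false]
    tauto
  simp [Dominates, h]

variable [Finite V]

theorem _root_.Dominates.splitAt {G : SimpleGraph V} {t : ℕ} {u v : V} (h : Dominates G t u v)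
    {X : Set V} (huv : u ∈ X ↔ v ∈ X) : Dominates (G.splitAt X) t u v := by
  refine (Set.ncard_le_ncard ?_ (Set.toFinite _)).trans h
  intro w
  simp only [splitAt_adj, Set.mem_ofPred_eq]
  tauto

theorem _root_.IsTDominating.splitAt {G : SimpleGraph V} {t : ℕ} (hG : IsTDominating G t)
    (X : Set V) : IsTDominating (G.splitAt X) t := by
  intro u v huv
  by_cases hu : u ∈ X <;> by_cases hv : v ∈ X
  · exact (hG u v huv).imp (·.splitAt (by tauto)) (·.splitAt (by tauto))
  · exact .inl (dominates_splitAt_of_mem_of_notMem G t hu hv)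
  · exact .inr (dominates_splitAt_of_mem_of_notMem G t hv hu)
  · exact (hG u v huv).imp (·.splitAt (by tauto)) (·.splitAt (by tauto))

theorem localDiffLE_splitAt {G : SimpleGraph V} {X : Set V} {d : ℕ}
    (hX : ∀ x ∈ X, {w | w ∈ X ∧ w ≠ x ∧ ¬ G.Adj w x}.ncard ≤ d)
    (hY : ∀ y ∉ X, {w | w ∉ X ∧ G.Adj w y}.ncard ≤ d) : LocalDiffLE G (G.splitAt X) d := by
  intro v
  by_cases hv : v ∈ X
  · have h₁ : G.neighborSet v \ (G.splitAt X).neighborSet v = ∅ := by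
      ext w
      have := @Adj.ne _ G v w
      simp only [splitAt_adj, Set.mem_sdiff, mem_neighborSet, Set.mem_empty_iff_false]
      tauto
    rw [h₁, Set.ncard_empty, zero_add]
    refine (Set.ncard_le_ncard ?_ (Set.toFinite _)).trans (hX v hv)
    intro w
    simp only [splitAt_adj, Set.mem_sdiff, mem_neighborSet, Set.mem_ofPred_eq, G.adj_comm w v,
      ne_comm (a := w)]
    tauto
  · have h₁ : (G.splitAt X).neighborSet v \ G.neighborSet v = ∅ := by
      ext w
      simp only [splitAt_adj, Set.mem_sdiff, mem_neighborSet, Set.mem_empty_iff_false]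
      tauto
    rw [h₁, Set.ncard_empty, add_zero]
    refine (Set.ncard_le_ncard ?_ (Set.toFinite _)).trans (hY v hv)
    intro w
    have := @Adj.ne _ G v w
    simp only [splitAt_adj, Set.mem_sdiff, mem_neighborSet, Set.mem_ofPred_eq, G.adj_comm w v]
    tauto

/-- In a `t`-dominating graph, a vertex `t`-dominates every vertex of at most its degree. -/
theorem _root_.IsTDominating.dominates {G : SimpleGraph V} {t : ℕ} (hG : IsTDominating G t)
    {u v : V} (h : (G.neighborSet v).ncard ≤ (G.neighborSet u).ncard) : Dominates G t u v := by
  rcases eq_or_ne u v with rfl | huv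
  · simp [Dominates]
  refine (hG u v huv).elim id fun hvu => le_trans ?_ hvu
  have key (a b : V) (hab : a ≠ b) : {w | w ≠ a ∧ w ≠ b ∧ G.Adj w b ∧ ¬ G.Adj w a} =
      (G.neighborSet b \ G.neighborSet a) \ {a} := by
    ext w
    have := @Adj.ne _ G w b
    simp only [Set.mem_ofPred_eq, Set.mem_sdiff, mem_neighborSet, Set.mem_singleton_iff,
      G.adj_comm b w, G.adj_comm a w]
    tauto
  have hdiff : (G.neighborSet v \ G.neighborSet u).ncard ≤
      (G.neighborSet u \ G.neighborSet v).ncard := by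
    have h₁ := Set.ncard_inter_add_ncard_sdiff_eq_ncard (G.neighborSet v) (G.neighborSet u)
      (Set.toFinite _)
    have h₂ := Set.ncard_inter_add_ncard_sdiff_eq_ncard (G.neighborSet u) (G.neighborSet v)
      (Set.toFinite _)
    rw [Set.inter_comm] at h₁
    omega
  rw [key u v huv, key v u huv.symm]
  by_cases hadj : G.Adj u v
  · rw [Set.ncard_sdiff_singleton_of_mem (by simp [hadj.symm]),
      Set.ncard_sdiff_singleton_of_mem (by simp [hadj])]
    omega
  · rwa [Set.sdiff_singleton_eq_self (by simp [G.adj_comm, hadj]),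
      Set.sdiff_singleton_eq_self (by simp [hadj])]

theorem _root_.IsTDominating.card_le {G : SimpleGraph V} {t : ℕ} (hG : IsTDominating G t)
    {u v : V} (h : (G.neighborSet v).ncard ≤ (G.neighborSet u).ncard) {S : Finset V}
    (hS : ∀ w ∈ S, w ≠ u ∧ G.Adj w v ∧ ¬ G.Adj w u) : S.card ≤ t := by
  rw [← Set.ncard_coe_finset]
  refine (Set.ncard_le_ncard ?_ (Set.toFinite _)).trans (hG.dominates h)
  intro w hw
  obtain ⟨h₁, h₂, h₃⟩ := hS w hw
  exact ⟨h₁, h₂.ne, h₂, h₃⟩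

/-- A set of non-neighbours of `x` and a set of neighbours of `y`, suitably placed in the degree
order, cannot both have more than `2t` elements: `t`-domination bounds the number of adjacent
pairs between them by `t |B|` and the number of non-adjacent ones by `t |A| + t`. -/
theorem _root_.IsTDominating.card_le_or_card_le {G : SimpleGraph V} {t : ℕ}
    (hG : IsTDominating G t) {x y : V} {A B : Finset V}
    (hxy : (G.neighborSet y).ncard ≤ (G.neighborSet x).ncard)
    (hA : ∀ a ∈ A, a ≠ x ∧ ¬ G.Adj a x ∧ (G.neighborSet y).ncard ≤ (G.neighborSet a).ncard)
    (hB : ∀ b ∈ B, G.Adj b y ∧ (G.neighborSet b).ncard ≤ (G.neighborSet x).ncard) :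
    A.card ≤ 2 * t ∨ B.card ≤ 2 * t := by
  classical
  by_contra! hcard
  have hinter : (A ∩ B).card ≤ t := by
    refine hG.card_le hxy fun w hw => ?_
    rw [Finset.mem_inter] at hw
    exact ⟨(hA w hw.1).1, (hB w hw.2).1, (hA w hw.1).2.1⟩
  have hadj : ∑ a ∈ A, (B.filter (G.Adj a)).card ≤ B.card * t := by
    have := Finset.sum_card_bipartiteAbove_eq_sum_card_bipartiteBelow G.Adj (s := A) (t := B)
    simp only [Finset.bipartiteAbove, Finset.bipartiteBelow] at this
    rw [this]
    refine Finset.sum_le_card_nsmul _ _ _ fun b hb => hG.card_le (hB b hb).2 fun w hw => ?_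
    rw [Finset.mem_filter] at hw
    exact ⟨(hA w hw.1).1, hw.2, (hA w hw.1).2.1⟩
  have hrow (a : V) (ha : a ∈ A) :
      B.card ≤ (B.filter (G.Adj a)).card + t + (if a ∈ B then 1 else 0) := by
    have h₁ : ((B.filter (¬ G.Adj a ·)).erase a).card ≤ t := by
      refine hG.card_le (hA a ha).2.2 fun w hw => ?_
      rw [Finset.mem_erase, Finset.mem_filter] at hw
      exact ⟨hw.1, (hB w hw.2.1).1, fun h => hw.2.2 h.symm⟩
    have h₂ := Finset.card_filter_add_card_filter_not (s := B) (G.Adj a)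
    have h₃ := Finset.card_erase_add_one (s := B.filter (¬ G.Adj a ·)) (a := a)
    have h₄ := Finset.erase_eq_of_notMem (s := B.filter (¬ G.Adj a ·)) (a := a)
    simp only [Finset.mem_filter, G.irrefl, not_false_eq_true, and_true] at h₃ h₄
    split_ifs with h
    · have := h₃ h
      omega
    · rw [h₄ h] at h₁
      omega
  have hsum := Finset.sum_le_sum hrow
  rw [Finset.sum_add_distrib, Finset.sum_add_distrib, Finset.sum_const, Finset.sum_const,
    ← Finset.card_filter, Finset.filter_mem_eq_inter, smul_eq_mul, smul_eq_mul] at hsum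
  have htotal : A.card * B.card ≤ B.card * t + A.card * t + t := by omega
  obtain ⟨p, hp⟩ := Nat.exists_eq_add_of_lt hcard.1
  obtain ⟨q, hq⟩ := Nat.exists_eq_add_of_lt hcard.2
  rw [hp, hq] at htotal
  nlinarith [Nat.zero_le (p * q), Nat.zero_le (t * p), Nat.zero_le (t * q)]

/-- A maximal set which is closed upwards in the degree order and in which every vertex has at
most `2t` non-neighbours has a complement in which every vertex has at most `2t` neighbours. -/
theorem _root_.IsTDominating.exists_partition {G : SimpleGraph V} {t : ℕ}
    (hG : IsTDominating G t) : ∃ X : Set V,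
      (∀ x ∈ X, {w | w ∈ X ∧ w ≠ x ∧ ¬ G.Adj w x}.ncard ≤ 2 * t) ∧
      ∀ y ∉ X, {w | w ∉ X ∧ G.Adj w y}.ncard ≤ 2 * t := by
  let P : Set V → Prop := fun X =>
    (∀ x ∈ X, ∀ y ∉ X, (G.neighborSet y).ncard ≤ (G.neighborSet x).ncard) ∧
    ∀ x ∈ X, {w | w ∈ X ∧ w ≠ x ∧ ¬ G.Adj w x}.ncard ≤ 2 * t
  obtain ⟨X, hX⟩ := (Set.toFinite {X | P X}).exists_maximal ⟨∅, by simp [P]⟩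
  refine ⟨X, hX.prop.2, fun y hy => ?_⟩
  by_contra! hcard
  obtain ⟨v, hv, hmax⟩ := (Set.toFinite Xᶜ).exists_maximalFor (fun v => (G.neighborSet v).ncard)
    _ ⟨y, hy⟩
  replace hmax (w : V) (hw : w ∉ X) : (G.neighborSet w).ncard ≤ (G.neighborSet v).ncard :=
    (le_total _ _).elim id fun h => hmax hw h
  have hup : ∀ x ∈ insert v X, ∀ w ∉ X, (G.neighborSet w).ncard ≤ (G.neighborSet x).ncard := by
    rintro x (rfl | hx) w hw
    · exact hmax w hw
    · exact hX.prop.1 x hx w hw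
  have hbad : ¬ P (insert v X) := fun h =>
    hv (hX.le_of_ge h (Set.subset_insert v X) (Set.mem_insert v X))
  obtain ⟨x, hx, hxcard⟩ : ∃ x ∈ insert v X,
      2 * t < {w | w ∈ insert v X ∧ w ≠ x ∧ ¬ G.Adj w x}.ncard := by
    by_contra! h
    exact hbad ⟨fun x hx w hw => hup x hx w fun h => hw (.inr h), h⟩
  rw [Set.ncard_eq_toFinset_card _ (Set.toFinite _)] at hcard hxcard
  refine (hG.card_le_or_card_le (hup x hx y hy) ?_ ?_).elim hxcard.not_ge hcard.not_ge
  · intro a ha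
    rw [Set.Finite.mem_toFinset] at ha
    exact ⟨ha.2.1, ha.2.2, hup a ha.1 y hy⟩
  · intro b hb
    rw [Set.Finite.mem_toFinset] at hb
    exact ⟨hb.2, hup x hx b hb.1⟩

end SimpleGraph

theorem statement_14 {V : Type*} [Fintype V] (t : ℕ) (G : SimpleGraph V)
    (hG : IsTDominating G t) :
    ∃ H : SimpleGraph V, IsTDominating H t ∧ IsSplitGraph H ∧ LocalDiffLE G H (2 * t) := by
  obtain ⟨X, hX, hY⟩ := hG.exists_partition
  exact ⟨G.splitAt X, hG.splitAt X, G.isSplitGraph_splitAt X, SimpleGraph.localDiffLE_splitAt hX hY⟩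
end
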